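/- arXiv:2604.23751 — 2 statements merged into one kernel-verified Lean document; each statement's English description precedes it below -/
import Mathlib

section
/- For each n ≥ 1, let σ_n be a uniformly random 321-avoiding permutation of {1,…,n}. Then the pairs of measures (π₁^{σ_n}, π₂^{σ_n}) satisfy a large deviation principle on D at speed n, with rate function H^{321}(π₁,π₂) := ∫₀¹ [ρ₁ log ρ₁ + (1−ρ₁) log(1−ρ₁) + ρ₂ log ρ₂ + (1−ρ₂) log(1−ρ₂) + 2 log 2] dLeb (with 0·log 0 = 0), where ρ₁, ρ₂ are the Lebesgue densities of π₁ and π₂ (which exist since π₁, π₂ ≤ Leb). -/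
open MeasureTheory Filter Set

attribute [local instance] Classical.propDecidable

noncomputable section

/-- `σ` avoids the pattern `321`. -/
def Avoids321 {n : ℕ} (σ : Equiv.Perm (Fin n)) : Prop :=
  ¬ ∃ i j k : Fin n, i < j ∧ j < k ∧ σ j < σ i ∧ σ k < σ j

/-- `(a, σ a)` is a strict right-to-left minimum of `σ`. -/
def IsStrictRLMin {n : ℕ} (σ : Equiv.Perm (Fin n)) (a : Fin n) : Prop :=
  σ a < a ∧ ∀ c : Fin n, a < c → σ a < σ c

/-- The set of positions of strict right-to-left minima of `σ`. -/
def RLMpositions {n : ℕ} (σ : Equiv.Perm (Fin n)) : Finset (Fin n) :=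
  Finset.univ.filter (fun a => IsStrictRLMin σ a)

/-- The measure `π₁^σ`. -/
def pi1 {n : ℕ} (σ : Equiv.Perm (Fin n)) : Measure ℝ :=
  ∑ a ∈ RLMpositions σ,
    volume.restrict (Set.Icc (((a : ℕ) : ℝ) / n) ((((a : ℕ) : ℝ) + 1) / n))

/-- The measure `π₂^σ`. -/
def pi2 {n : ℕ} (σ : Equiv.Perm (Fin n)) : Measure ℝ :=
  ∑ a ∈ RLMpositions σ,
    volume.restrict
      (Set.Icc ((((σ a : Fin n) : ℕ) : ℝ) / n) (((((σ a : Fin n) : ℕ) : ℝ) + 1) / n))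

/-- Lebesgue measure on `[0,1]`. -/
def Leb01 : Measure ℝ := volume.restrict (Set.Icc (0:ℝ) 1)

/-- The defining property of the space `D`. -/
def MemD (π₁ π₂ : Measure ℝ) : Prop :=
  π₁ ≤ Leb01 ∧ π₂ ≤ Leb01 ∧ π₁ Set.univ = π₂ Set.univ ∧
    ∀ x : ℝ, π₁ (Set.Icc 0 x) ≤ π₂ (Set.Icc 0 x)

/-- The space `D` of pairs of subuniform measures on `[0,1]` with equal total mass and
ordered cumulative distribution functions, with the topology of weak convergence. -/
def Dspace : Type :=
  {p : FiniteMeasure ℝ × FiniteMeasure ℝ //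
    MemD (p.1 : Measure ℝ) (p.2 : Measure ℝ)}

instance : TopologicalSpace Dspace := by unfold Dspace; infer_instance

/-- The Lebesgue density of a (subuniform) measure on `[0,1]`. -/
def dens (π : FiniteMeasure ℝ) (x : ℝ) : ℝ :=
  ((π : Measure ℝ).rnDeriv volume x).toReal

/-- Entropy-type integrand: `ρ log ρ + (1−ρ) log(1−ρ) + log 2` (with `0 log 0 = 0`). -/
def entTerm (r : ℝ) : ℝ :=
  r * Real.log r + (1 - r) * Real.log (1 - r) + Real.log 2

/-- The rate function
`H^{321}(π₁,π₂) = ∫₀¹ [ρ₁ log ρ₁ + (1−ρ₁) log(1−ρ₁) + ρ₂ log ρ₂ + (1−ρ₂) log(1−ρ₂) + 2 log 2] dLeb`. -/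
def H321 (p : Dspace) : EReal :=
  ((∫ x in Set.Icc (0:ℝ) 1, (entTerm (dens p.1.1 x) + entTerm (dens p.1.2 x)) : ℝ) : EReal)

/-- A sequence of set functions `p n` (probabilities of events) satisfies a large
deviation principle at speed `n` with rate function `I` (a nonnegative lower
semicontinuous function with values in `[0,∞]`). -/
def SatisfiesLDP {X : Type*} [TopologicalSpace X]
    (p : ℕ → Set X → ENNReal) (I : X → EReal) : Prop :=
  LowerSemicontinuous I ∧ (∀ x, 0 ≤ I x) ∧
  (∀ F : Set X, IsClosed F →
    Filter.limsup (fun n : ℕ => (((n : ℝ)⁻¹ : ℝ) : EReal) * ENNReal.log (p n F))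
      Filter.atTop ≤ - ⨅ x ∈ F, I x) ∧
  (∀ O : Set X, IsOpen O →
    - ⨅ x ∈ O, I x ≤
      Filter.liminf (fun n : ℕ => (((n : ℝ)⁻¹ : ℝ) : EReal) * ENNReal.log (p n O))
        Filter.atTop)

/-- Probability that a uniform `321`-avoiding permutation of size `n` has its pair of
RLM occupation measures in `S`. -/
def probUnif321 (Pi : ∀ n : ℕ, Equiv.Perm (Fin n) → Dspace) (n : ℕ)
    (S : Set Dspace) : ENNReal :=
  ((Finset.univ.filter
      (fun σ : Equiv.Perm (Fin n) => Avoids321 σ ∧ Pi n σ ∈ S)).card : ENNReal) /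
    ((Finset.univ.filter (fun σ : Equiv.Perm (Fin n) => Avoids321 σ)).card : ENNReal)

namespace LDP321

open Real
open scoped BoundedContinuousFunction Topology NNReal ENNReal

/-! ### Combinatorics of `321`-avoiding permutations -/

lemma lt_of_avoids321_of_lt {n : ℕ} {σ : Equiv.Perm (Fin n)} (h : Avoids321 σ) {a c : Fin n}
    (ha : σ a < a) (hac : a < c) : σ a < σ c := by
  by_contra hc
  have hc' : σ c < σ a := lt_of_le_of_ne (not_lt.1 hc) fun e => hac.ne' (σ.injective e)
  have hno : ∀ i, i < a → σ i < σ a := fun i hi => by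
    by_contra h'
    have h1 : σ a < σ i := lt_of_le_of_ne (not_lt.1 h') fun e => hi.ne' (σ.injective e)
    exact h ⟨i, a, c, hi, hac, h1, hc'⟩
  have hsub : (insert c (Finset.Iio a)).image σ ⊆ Finset.Iio (σ a) := by
    intro x hx
    simp only [Finset.mem_image, Finset.mem_insert, Finset.mem_Iio] at hx ⊢
    obtain ⟨y, rfl | hy, rfl⟩ := hx
    · exact hc'
    · exact hno y hy
  have hcard := Finset.card_le_card hsub
  rw [Finset.card_image_of_injective _ σ.injective, Finset.card_insert_of_notMem
    (by simp [hac.le]), Fin.card_Iio, Fin.card_Iio] at hcard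
  have : (σ a : ℕ) < a := ha
  omega

lemma lt_of_avoids321_of_le {n : ℕ} {σ : Equiv.Perm (Fin n)} (h : Avoids321 σ) {i j : Fin n}
    (hj : j ≤ σ j) (hij : i < j) : σ i < σ j := by
  by_contra hc
  have hc' : σ j < σ i := lt_of_le_of_ne (not_lt.1 hc) fun e => hij.ne' (σ.injective e)
  have hsub : (Finset.Iio (σ j)).image σ.symm ⊆ (Finset.Iio j).erase i := by
    intro x hx
    simp only [Finset.mem_image, Finset.mem_Iio, Finset.mem_erase] at hx ⊢
    obtain ⟨y, hy, rfl⟩ := hx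
    refine ⟨fun e => ?_, ?_⟩
    · rw [← e, Equiv.apply_symm_apply] at hc'
      exact lt_asymm hy hc'
    · by_contra hk
      rcases (not_lt.1 hk).eq_or_lt with e | hk
      · rw [e, Equiv.apply_symm_apply] at hy
        exact lt_irrefl _ hy
      · exact h ⟨i, j, σ.symm y, hij, hk, hc', by simpa using hy⟩
  have hcard := Finset.card_le_card hsub
  rw [Finset.card_image_of_injective _ σ.symm.injective, Finset.card_erase_of_mem (by simpa),
    Fin.card_Iio, Fin.card_Iio] at hcard
  have h1 : (i : ℕ) < j := hij
  have h2 : (j : ℕ) ≤ σ j := hj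
  omega

lemma mem_RLMpositions_iff {n : ℕ} {σ : Equiv.Perm (Fin n)} (h : Avoids321 σ) (a : Fin n) :
    a ∈ RLMpositions σ ↔ σ a < a := by
  have e : a ∈ RLMpositions σ ↔ a ∈ Finset.univ ∧ IsStrictRLMin σ a := Finset.mem_filter
  rw [e]
  exact ⟨fun h => h.2.1, fun ha =>
      ⟨Finset.mem_univ a, ha, fun c hc => lt_of_avoids321_of_lt h ha hc⟩⟩

lemma perm_eq_of_strictMonoOn {n : ℕ} {σ τ : Equiv.Perm (Fin n)} {A : Set (Fin n)}
    (h1 : StrictMonoOn σ A) (h2 : StrictMonoOn τ A) (h3 : StrictMonoOn σ Aᶜ)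
    (h4 : StrictMonoOn τ Aᶜ) (h : σ '' A = τ '' A) : σ = τ := by
  have key : ∀ B : Set (Fin n), StrictMonoOn σ B → StrictMonoOn τ B → σ '' B = τ '' B →
      ∀ a ∈ B, σ a = τ a := by
    intro B hs ht he a ha
    have e : B.domRestrict σ = B.domRestrict τ :=
      (StrictMono.range_inj (strictMono_domRestrict.2 hs) (strictMono_domRestrict.2 ht)).1
        (by simpa [range_domRestrict] using he)
    exact congrFun e ⟨a, ha⟩
  ext a
  by_cases ha : a ∈ A
  · rw [key A h1 h2 h a ha]
  · rw [key Aᶜ h3 h4 (by rw [image_compl_eq σ.bijective, image_compl_eq τ.bijective, h]) a ha]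

lemma strictMonoOn_RLMpositions {n : ℕ} {σ : Equiv.Perm (Fin n)} (h : Avoids321 σ) :
    StrictMonoOn σ (RLMpositions σ : Set (Fin n)) := fun a ha _ _ hab =>
  lt_of_avoids321_of_lt h ((mem_RLMpositions_iff h a).1 ha) hab

lemma strictMonoOn_compl_RLMpositions {n : ℕ} {σ : Equiv.Perm (Fin n)} (h : Avoids321 σ) :
    StrictMonoOn σ (RLMpositions σ : Set (Fin n))ᶜ := fun _ _ b hb hab =>
  lt_of_avoids321_of_le h (not_lt.1 fun hb' => hb ((mem_RLMpositions_iff h b).2 hb')) hab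

/-- The positions and the values of the strict right-to-left minima. -/
def rlmPair {n : ℕ} (σ : Equiv.Perm (Fin n)) : Finset (Fin n) × Finset (Fin n) :=
  (RLMpositions σ, (RLMpositions σ).image σ)

lemma rlmPair_injOn (n : ℕ) : InjOn (rlmPair (n := n)) {σ | Avoids321 σ} := by
  intro σ hσ τ hτ h
  simp only [rlmPair, Prod.mk.injEq] at h
  have hA := h.1
  have hB : σ '' (RLMpositions σ : Set (Fin n)) = τ '' (RLMpositions σ : Set (Fin n)) := by
    have := h.2
    rw [← hA] at this
    exact_mod_cast congrArg (fun s : Finset (Fin n) => (s : Set (Fin n))) this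
  refine perm_eq_of_strictMonoOn (strictMonoOn_RLMpositions hσ) ?_
    (strictMonoOn_compl_RLMpositions hσ) ?_ hB
  · rw [hA]; exact strictMonoOn_RLMpositions hτ
  · rw [hA]; exact strictMonoOn_compl_RLMpositions hτ

/-- A pair of sets of positions and values which is realised by the strict right-to-left minima
of a `321`-avoiding permutation. -/
def Admissible {n : ℕ} (A B : Finset (Fin n)) : Prop :=
  A.card = B.card ∧ ∀ x : Fin n, (A.filter (· ≤ x)).card ≤ (B.filter (· < x)).card

lemma exists_perm_strictMonoOn {n : ℕ} {A B : Finset (Fin n)} (h : A.card = B.card) :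
    ∃ σ : Equiv.Perm (Fin n), StrictMonoOn σ (A : Set (Fin n)) ∧
      StrictMonoOn σ (A : Set (Fin n))ᶜ ∧ A.image σ = B := by
  have hc : Aᶜ.card = Bᶜ.card := by simp [Finset.card_compl, h]
  let e : A ≃o B := (A.orderIsoOfFin rfl).symm.trans (B.orderIsoOfFin h.symm)
  let f : (Aᶜ : Finset (Fin n)) ≃o (Bᶜ : Finset (Fin n)) :=
    ((Aᶜ).orderIsoOfFin rfl).symm.trans ((Bᶜ).orderIsoOfFin hc.symm)
  let f' : {x // ¬ x ∈ A} ≃ {x // ¬ x ∈ B} :=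
    ((Equiv.subtypeEquivRight fun x => by simp).trans f.toEquiv).trans
      (Equiv.subtypeEquivRight fun x => by simp)
  let σ : Equiv.Perm (Fin n) := Equiv.subtypeCongr (p := (· ∈ A)) (q := (· ∈ B)) e.toEquiv f'
  have hσA : ∀ a (ha : a ∈ A), σ a = e ⟨a, ha⟩ := fun a ha => by
    simp [σ, Equiv.subtypeCongr, Equiv.sumCompl_symm_apply_of_pos (p := (· ∈ A)) ha]
  have hσc : ∀ a (ha : a ∉ A), σ a = f ⟨a, by simpa using ha⟩ := fun a ha => by
    simp only [σ, Equiv.subtypeCongr, Equiv.trans_apply,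
      Equiv.sumCompl_symm_apply_of_neg (p := (· ∈ A)) ha]
    rfl
  refine ⟨σ, ?_, ?_, ?_⟩
  · intro a ha b hb hab
    rw [hσA a ha, hσA b hb]
    exact e.strictMono (a := ⟨a, ha⟩) (b := ⟨b, hb⟩) hab
  · intro a ha b hb hab
    rw [hσc a ha, hσc b hb]
    exact f.strictMono (a := ⟨a, _⟩) (b := ⟨b, _⟩) hab
  · apply Finset.eq_of_subset_of_card_le
    · intro x hx
      obtain ⟨a, ha, rfl⟩ := Finset.mem_image.1 hx
      rw [hσA a ha]
      exact (e ⟨a, ha⟩).2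
    · rw [Finset.card_image_of_injective _ σ.injective, h]

lemma exists_avoids321_of_admissible {n : ℕ} {A B : Finset (Fin n)} (h : Admissible A B) :
    ∃ σ : Equiv.Perm (Fin n), Avoids321 σ ∧ rlmPair σ = (A, B) := by
  obtain ⟨σ, hA, hAc, hB⟩ := exists_perm_strictMonoOn h.1
  have hmemB : ∀ a, σ a ∈ B ↔ a ∈ A := fun a => by
    rw [← hB]; simp
  have hlt : ∀ a ∈ A, σ a < a := by
    intro a ha
    by_contra hle
    have hsub : B.filter (· < a) ⊆ (A.filter (· < a)).image σ := by
      intro b hb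
      obtain ⟨hb, hba⟩ := Finset.mem_filter.1 hb
      rw [← hB] at hb
      obtain ⟨c, hc, rfl⟩ := Finset.mem_image.1 hb
      refine Finset.mem_image_of_mem _ (Finset.mem_filter.2 ⟨hc, ?_⟩)
      by_contra hca
      exact absurd (hA.monotoneOn ha hc (not_lt.1 hca)) (not_le.2 (hba.trans_le (not_lt.1 hle)))
    have h1 := (Finset.card_le_card hsub).trans Finset.card_image_le
    have h2 : A.filter (· < a) ⊂ A.filter (· ≤ a) := by
      refine Finset.ssubset_iff_of_subset (Finset.monotone_filter_right _ fun x _ hx => hx.le) |>.2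
        ⟨a, by simp [ha], by simp⟩
    exact absurd (h.2 a) (not_le.2 (h1.trans_lt (Finset.card_lt_card h2)))
  have hle : ∀ a ∉ A, a ≤ σ a := by
    intro a ha
    by_contra hlt'
    have hsub : ((Aᶜ).filter (· ≤ a)).image σ ⊆ (Bᶜ).filter (· < a) := by
      intro b hb
      obtain ⟨c, hc, rfl⟩ := Finset.mem_image.1 hb
      obtain ⟨hc, hca⟩ := Finset.mem_filter.1 hc
      rw [Finset.mem_compl] at hc
      refine Finset.mem_filter.2 ⟨by simpa [hmemB] using hc, ?_⟩
      exact (hAc.monotoneOn (a := c) (b := a) hc ha hca).trans_lt (not_le.1 hlt')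
    have h1 := Finset.card_le_card hsub
    rw [Finset.card_image_of_injective _ σ.injective] at h1
    have e1 : ((Aᶜ).filter (· ≤ a)).card + (A.filter (· ≤ a)).card = (a : ℕ) + 1 := by
      rw [← Fin.card_Iic, ← Finset.card_union_of_disjoint]
      · congr 1; ext x; simp; tauto
      · exact Finset.disjoint_filter_filter (by simpa using disjoint_compl_left)
    have e2 : ((Bᶜ).filter (· < a)).card + (B.filter (· < a)).card = (a : ℕ) := by
      rw [← Fin.card_Iio, ← Finset.card_union_of_disjoint]
      · congr 1; ext x; simp; tauto
      · exact Finset.disjoint_filter_filter (by simpa using disjoint_compl_left)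
    have := h.2 a
    omega
  have hav : Avoids321 σ := by
    rintro ⟨i, j, k, hij, hjk, h1, h2⟩
    have hj : j ∈ A := by
      by_contra hj
      have hi : i ∈ A := by
        by_contra hi
        exact lt_asymm h1 (hAc hi hj hij)
      exact lt_asymm h1 (((hlt i hi).trans hij).trans_le (hle j hj))
    have hk : k ∈ A := by
      by_contra hk
      exact lt_asymm h2 (((hlt j hj).trans hjk).trans_le (hle k hk))
    exact lt_asymm h2 (hA hj hk hjk)
  refine ⟨σ, hav, ?_⟩
  have : RLMpositions σ = A := by
    ext a
    rw [mem_RLMpositions_iff hav]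
    exact ⟨fun h' => by_contra fun ha => absurd (hle a ha) (not_le.2 h'), hlt a⟩
  simp [rlmPair, this, hB]

/-! ### Sets with prescribed numbers of elements in blocks -/

/-- Subsets of `{0, …, k * m - 1}` with exactly `c j` elements below `j * m`, for all `j ≤ k`. -/
def blockSets (m : ℕ) (c : ℕ → ℕ) (k : ℕ) : Finset (Finset ℕ) :=
  (Finset.range (k * m)).powerset.filter
    fun A => ∀ j ≤ k, (A ∩ Finset.range (j * m)).card = c j

lemma mem_blockSets {m : ℕ} {c : ℕ → ℕ} {k : ℕ} {A : Finset ℕ} :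
    A ∈ blockSets m c k ↔
      A ⊆ Finset.range (k * m) ∧ ∀ j ≤ k, (A ∩ Finset.range (j * m)).card = c j := by
  unfold blockSets
  rw [Finset.mem_filter, Finset.mem_powerset]

lemma prod_choose_le_card_blockSets (m : ℕ) (c : ℕ → ℕ) (h0 : c 0 = 0) (hc : Monotone c)
    (k : ℕ) : ∏ j ∈ Finset.range k, m.choose (c (j + 1) - c j) ≤ (blockSets m c k).card := by
  induction k with
  | zero =>
    rw [Finset.prod_range_zero, Nat.one_le_iff_ne_zero, Finset.card_ne_zero]
    refine ⟨∅, mem_blockSets.2 ⟨by simp, fun j hj => ?_⟩⟩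
    obtain rfl := Nat.le_zero.1 hj
    simp [h0]
  | succ k ih =>
    rw [Finset.prod_range_succ]
    set T := Finset.powersetCard (c (k + 1) - c k) (Finset.Ico (k * m) ((k + 1) * m)) with hT
    have hTc : T.card = m.choose (c (k + 1) - c k) := by
      rw [hT, Finset.card_powersetCard, Nat.card_Ico, add_mul, one_mul, Nat.add_sub_cancel_left]
    have hkm : ∀ j ≤ k, j * m ≤ k * m := fun j hj => Nat.mul_le_mul_right m hj
    have hk1 : k * m ≤ (k + 1) * m := Nat.mul_le_mul_right m k.le_succ
    have hinter : ∀ A S : Finset ℕ, A ⊆ Finset.range (k * m) →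
        S ⊆ Finset.Ico (k * m) ((k + 1) * m) →
        (A ∪ S) ∩ Finset.range (k * m) = A ∧ (A ∪ S) \ Finset.range (k * m) = S := by
      intro A S hA hS
      constructor
      · ext x
        have h1 := @hA x
        have h2 := @hS x
        simp only [Finset.mem_range, Finset.mem_Ico, Finset.mem_inter, Finset.mem_union] at *
        grind
      · ext x
        have h1 := @hA x
        have h2 := @hS x
        simp only [Finset.mem_range, Finset.mem_Ico, Finset.mem_sdiff, Finset.mem_union] at *
        grind
    calc _ ≤ ((blockSets m c k) ×ˢ T).card := by
          rw [Finset.card_product, hTc]; gcongr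
      _ ≤ _ := by
          refine Finset.card_le_card_of_injOn (fun p => p.1 ∪ p.2) ?_ ?_
          · rintro ⟨A, S⟩ hp
            obtain ⟨hA, hS⟩ := Finset.mem_product.1 hp
            obtain ⟨hA1, hA2⟩ := mem_blockSets.1 hA
            obtain ⟨hS1, hS2⟩ := Finset.mem_powersetCard.1 hS
            have hd : Disjoint A S := by
              refine Finset.disjoint_left.2 fun x hx hx' => ?_
              have h1 := Finset.mem_range.1 (hA1 hx)
              have h2 := (Finset.mem_Ico.1 (hS1 hx')).1
              omega
            refine mem_blockSets.2 ⟨?_, fun j hj => ?_⟩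
            · refine Finset.union_subset (hA1.trans (Finset.range_subset_range.2 hk1))
                fun x hx => ?_
              exact Finset.mem_range.2 (Finset.mem_Ico.1 (hS1 hx)).2
            · rcases Nat.le_succ_iff.1 hj with hj | rfl
              · rw [← hA2 j hj]
                congr 1
                rw [← (hinter A S hA1 hS1).1, Finset.inter_assoc, Finset.inter_eq_right.2
                  (Finset.range_subset_range.2 (hkm j hj)), (hinter A S hA1 hS1).1]
              · have h3 := hA2 k le_rfl
                rw [Finset.inter_eq_left.2 hA1] at h3
                have h4 : A ∪ S ⊆ Finset.range ((k + 1) * m) :=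
                  Finset.union_subset (hA1.trans (Finset.range_subset_range.2 hk1))
                    fun x hx => Finset.mem_range.2 (Finset.mem_Ico.1 (hS1 hx)).2
                rw [Finset.inter_eq_left.2 h4, Finset.card_union_of_disjoint hd, h3, hS2]
                have := hc k.le_succ
                simp only [Nat.succ_eq_add_one] at this ⊢
                omega
          · rintro ⟨A, S⟩ hp ⟨A', S'⟩ hp' he
            obtain ⟨hA, hS⟩ := Finset.mem_product.1 hp
            obtain ⟨hA', hS'⟩ := Finset.mem_product.1 hp'
            have i1 := hinter A S (mem_blockSets.1 hA).1 (Finset.mem_powersetCard.1 hS).1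
            have i2 := hinter A' S' (mem_blockSets.1 hA').1 (Finset.mem_powersetCard.1 hS').1
            simp only at he
            rw [he] at i1
            rw [Prod.mk.injEq, ← i1.1, ← i1.2, i2.1, i2.2]
            exact ⟨rfl, rfl⟩

/-- The elements of a set of natural numbers that are less than `n`. -/
def toFin (n : ℕ) (A : Finset ℕ) : Finset (Fin n) := Finset.univ.filter fun i => (i : ℕ) ∈ A

lemma mem_toFin {n : ℕ} {A : Finset ℕ} {i : Fin n} : i ∈ toFin n A ↔ (i : ℕ) ∈ A := by
  unfold toFin
  rw [Finset.mem_filter]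
  simp

lemma image_val_toFin {n : ℕ} {A : Finset ℕ} (hA : A ⊆ Finset.range n) :
    (toFin n A).image Fin.val = A := by
  ext x
  simp only [Finset.mem_image, mem_toFin]
  exact ⟨by rintro ⟨i, hi, rfl⟩; exact hi, fun hx => ⟨⟨x, Finset.mem_range.1 (hA hx)⟩, hx, rfl⟩⟩

lemma card_toFin {n : ℕ} {A : Finset ℕ} (hA : A ⊆ Finset.range n) :
    (toFin n A).card = A.card := by
  conv_rhs => rw [← image_val_toFin hA]
  exact (Finset.card_image_of_injective _ Fin.val_injective).symm

lemma card_filter_toFin {n : ℕ} {A : Finset ℕ} (hA : A ⊆ Finset.range n) (y : ℕ) :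
    ((toFin n A).filter fun i : Fin n => (i : ℕ) < y).card = (A ∩ Finset.range y).card := by
  rw [← card_toFin (n := n) (A := A ∩ Finset.range y) (Finset.inter_subset_left.trans hA)]
  congr 1
  ext x
  simp [mem_toFin]

lemma admissible_toFin {n m K : ℕ} (hm : 0 < m) (hn : (K + 1) * m ≤ n) {c d : ℕ → ℕ}
    (hcd : ∀ k ≤ K, c (k + 1) ≤ d k) (he : c (K + 1) = d (K + 1)) {A B : Finset ℕ}
    (hA : A ∈ blockSets m c (K + 1)) (hB : B ∈ blockSets m d (K + 1)) :
    Admissible (toFin n A) (toFin n B) := by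
  obtain ⟨hA1, hA2⟩ := mem_blockSets.1 hA
  obtain ⟨hB1, hB2⟩ := mem_blockSets.1 hB
  have hAn := hA1.trans (Finset.range_subset_range.2 hn)
  have hBn := hB1.trans (Finset.range_subset_range.2 hn)
  have hcard : A.card = B.card := by
    rw [← Finset.inter_eq_left.2 hA1, ← Finset.inter_eq_left.2 hB1, hA2 _ le_rfl, hB2 _ le_rfl, he]
  refine ⟨by rw [card_toFin hAn, card_toFin hBn, hcard], fun x => ?_⟩
  have e1 : (toFin n A).filter (· ≤ x) =
        (toFin n A).filter fun i : Fin n => (i : ℕ) < (x : ℕ) + 1 := by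
    ext i; simp
  have e2 : (toFin n B).filter (· < x) = (toFin n B).filter fun i : Fin n => (i : ℕ) < (x : ℕ) := by
    ext i; simp
  rw [e1, e2, card_filter_toFin hAn, card_filter_toFin hBn]
  rcases le_or_gt ((K + 1) * m) x with hx | hx
  · rw [Finset.inter_eq_left.2 (hB1.trans (Finset.range_subset_range.2 hx)), ← hcard]
    exact Finset.card_le_card Finset.inter_subset_left
  · have hk : (x : ℕ) / m ≤ K := Nat.lt_succ_iff.1 ((Nat.div_lt_iff_lt_mul hm).2 hx)
    have hx1 : (x : ℕ) / m * m ≤ x := Nat.div_mul_le_self _ _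
    have hx2 : (x : ℕ) + 1 ≤ ((x : ℕ) / m + 1) * m := by
      have := Nat.lt_div_mul_add (a := (x : ℕ)) hm
      rw [add_mul]; omega
    calc _ ≤ (A ∩ Finset.range (((x : ℕ) / m + 1) * m)).card := by gcongr
      _ = c ((x : ℕ) / m + 1) := hA2 _ (by omega)
      _ ≤ d ((x : ℕ) / m) := hcd _ hk
      _ = (B ∩ Finset.range ((x : ℕ) / m * m)).card := (hB2 _ (by omega)).symm
      _ ≤ _ := by gcongr

lemma prod_choose_le_card_avoids321 {n m K : ℕ} (hm : 0 < m) (hn : (K + 1) * m ≤ n)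
    {c d : ℕ → ℕ} (hc0 : c 0 = 0) (hd0 : d 0 = 0) (hc : Monotone c) (hd : Monotone d)
    (hcd : ∀ k ≤ K, c (k + 1) ≤ d k) (he : c (K + 1) = d (K + 1))
    (P : Equiv.Perm (Fin n) → Prop)
    (hP : ∀ σ, Avoids321 σ → ∀ A ∈ blockSets m c (K + 1), ∀ B ∈ blockSets m d (K + 1),
      rlmPair σ = (toFin n A, toFin n B) → P σ) :
    (∏ j ∈ Finset.range (K + 1), m.choose (c (j + 1) - c j)) *
      (∏ j ∈ Finset.range (K + 1), m.choose (d (j + 1) - d j)) ≤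
    (Finset.univ.filter fun σ : Equiv.Perm (Fin n) => Avoids321 σ ∧ P σ).card := by
  calc _ ≤ (blockSets m c (K + 1) ×ˢ blockSets m d (K + 1)).card := by
        rw [Finset.card_product]
        exact Nat.mul_le_mul (prod_choose_le_card_blockSets m c hc0 hc _)
          (prod_choose_le_card_blockSets m d hd0 hd _)
    _ ≤ _ := by
        have hex : ∀ p ∈ blockSets m c (K + 1) ×ˢ blockSets m d (K + 1),
            ∃ σ : Equiv.Perm (Fin n), Avoids321 σ ∧ rlmPair σ = (toFin n p.1, toFin n p.2) :=
          fun p hp => exists_avoids321_of_admissible (admissible_toFin hm hn hcd he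
            (Finset.mem_product.1 hp).1 (Finset.mem_product.1 hp).2)
        choose! f hf using hex
        refine Finset.card_le_card_of_injOn f ?_ ?_
        · intro p hp
          refine Finset.mem_coe.2 (Finset.mem_filter.2 ⟨Finset.mem_univ _, (hf p hp).1, ?_⟩)
          exact hP _ (hf p hp).1 p.1 (Finset.mem_product.1 hp).1 p.2 (Finset.mem_product.1 hp).2
            (hf p hp).2
        · rintro ⟨A, B⟩ hp ⟨A', B'⟩ hp' h
          have h1 := (hf _ hp).2
          rw [h, (hf _ hp').2, Prod.mk.injEq] at h1
          have hsub : ∀ {c : ℕ → ℕ} {A}, A ∈ blockSets m c (K + 1) → A ⊆ Finset.range n :=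
            fun hA => (mem_blockSets.1 hA).1.trans (Finset.range_subset_range.2 hn)
          have hp1 : A ∈ _ ∧ B ∈ _ := Finset.mem_product.1 hp
          have hp2 : A' ∈ _ ∧ B' ∈ _ := Finset.mem_product.1 hp'
          rw [Prod.mk.injEq, ← image_val_toFin (hsub hp1.1), ← image_val_toFin (hsub hp1.2),
            ← image_val_toFin (hsub hp2.1), ← image_val_toFin (hsub hp2.2)]
          exact ⟨congrArg _ h1.1.symm, congrArg _ h1.2.symm⟩

lemma mul_log_ratio_le {r s : ℝ} (hr : 0 ≤ r) (hs : 0 < s) :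
    r * log s - r * log r ≤ s - r := by
  rcases hr.eq_or_lt with rfl | hr
  · simpa using hs.le
  · have := log_le_sub_one_of_pos (div_pos hs hr)
    rw [log_div hs.ne' hr.ne'] at this
    have h2 : r * (s / r) = s := by field_simp
    nlinarith [mul_le_mul_of_nonneg_left this hr.le]

/-- The softplus function, the convex conjugate of `-binEntropy`. -/
def softplus (x : ℝ) : ℝ := log (1 + exp x)

lemma softplus_nonneg (x : ℝ) : 0 ≤ softplus x := log_nonneg (by linarith [exp_pos x])

lemma continuous_softplus : Continuous softplus := by
  unfold softplus
  exact Continuous.log (by fun_prop) fun x => by positivity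

lemma entTerm_eq (r : ℝ) : entTerm r = log 2 - binEntropy r := by
  unfold entTerm binEntropy; simp only [log_inv]; ring

lemma softplus_eq_neg_log {s : ℝ} (h0 : 0 < s) (h1 : s < 1) :
    softplus (log (s / (1 - s))) = -log (1 - s) := by
  unfold softplus
  rw [exp_log (div_pos h0 (by linarith)), ← log_inv]
  congr 1
  field_simp [(by linarith : (1 - s) ≠ 0)]
  ring

lemma mul_add_binEntropy_le {r : ℝ} (h0 : 0 ≤ r) (h1 : r ≤ 1) (x : ℝ) :
    r * x + binEntropy r ≤ softplus x := by
  have hp : 0 < 1 + exp x := by positivity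
  have hs : (0 : ℝ) < exp x / (1 + exp x) := by positivity
  have hs1 : (0 : ℝ) < 1 / (1 + exp x) := by positivity
  have e1 := mul_log_ratio_le h0 hs
  have e2 := mul_log_ratio_le (sub_nonneg.2 h1) hs1
  rw [log_div (exp_pos x).ne' hp.ne', log_exp] at e1
  rw [log_div one_ne_zero hp.ne', log_one] at e2
  have : exp x / (1 + exp x) + 1 / (1 + exp x) = 1 := by field_simp; ring
  unfold softplus binEntropy
  simp only [log_inv]
  nlinarith

lemma exists_mul_add_binEntropy_eq (x : ℝ) :
    ∃ r, 0 ≤ r ∧ r ≤ 1 ∧ r * x + binEntropy r = softplus x := by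
  have hp : 0 < 1 + exp x := by positivity
  refine ⟨exp x / (1 + exp x), by positivity, (div_le_one hp).2 (by linarith), ?_⟩
  have : 1 - exp x / (1 + exp x) = 1 / (1 + exp x) := by field_simp; ring
  unfold softplus binEntropy
  rw [this]
  simp only [log_inv]
  rw [log_div (exp_pos x).ne' hp.ne', log_exp, log_div one_ne_zero hp.ne', log_one]
  field_simp
  ring

lemma softplus_le_add (x y : ℝ) : softplus x ≤ softplus y + |x - y| := by
  obtain ⟨r, h0, h1, h⟩ := exists_mul_add_binEntropy_eq x
  have := mul_add_binEntropy_le h0 h1 y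
  have h2 : r * (x - y) ≤ |x - y| := by
    nlinarith [le_abs_self (x - y), abs_nonneg (x - y)]
  nlinarith

lemma neg_binEntropy_add_le {r δ : ℝ} (h0 : 0 ≤ r) (h1 : r ≤ 1) (hδ : 0 < δ) (hδ' : δ < 1 / 2) :
    -binEntropy r + log (1 - 2 * δ) ≤
      r * log (((1 - 2 * δ) * r + δ) / (1 - ((1 - 2 * δ) * r + δ))) -
        softplus (log (((1 - 2 * δ) * r + δ) / (1 - ((1 - 2 * δ) * r + δ)))) := by
  have hp : 0 < 1 - 2 * δ := by linarith
  set s := (1 - 2 * δ) * r + δ with hs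
  have hs0 : 0 < s := by positivity
  have hs1 : 0 < 1 - s := by nlinarith
  rw [softplus_eq_neg_log hs0 (by linarith), log_div hs0.ne' hs1.ne']
  have key : ∀ {t u : ℝ}, 0 ≤ t → (1 - 2 * δ) * t ≤ u →
      t * log t + t * log (1 - 2 * δ) ≤ t * log u := by
    intro t u ht htu
    rcases ht.eq_or_lt with rfl | ht
    · simp
    · rw [← mul_add, ← log_mul ht.ne' hp.ne']
      refine mul_le_mul_of_nonneg_left (log_le_log (by positivity) (by linarith)) ht.le
  have e1 := key h0 (u := s) (by linarith)
  have e2 := key (sub_nonneg.2 h1) (u := 1 - s) (by nlinarith)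
  unfold binEntropy
  simp only [log_inv]
  nlinarith

section Subuniform

variable {μ : FiniteMeasure ℝ}

instance : IsFiniteMeasure Leb01 := by unfold Leb01; infer_instance

lemma leb01_le_volume : Leb01 ≤ volume := Measure.restrict_le_self

lemma measurable_dens (μ : FiniteMeasure ℝ) : Measurable (dens μ) :=
  (Measure.measurable_rnDeriv _ _).ennreal_toReal

lemma dens_nonneg (μ : FiniteMeasure ℝ) (x : ℝ) : 0 ≤ dens μ x := ENNReal.toReal_nonneg

lemma dens_le_one (h : (μ : Measure ℝ) ≤ Leb01) : ∀ᵐ x ∂Leb01, dens μ x ≤ 1 := by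
  have h1 : (μ : Measure ℝ) ≤ volume := h.trans leb01_le_volume
  have := Measure.rnDeriv_le_one_of_le h1
  refine ae_restrict_of_ae (this.mono fun x hx => ?_)
  have := ENNReal.toReal_mono ENNReal.one_ne_top hx
  simpa [dens] using this

lemma measure_compl_Icc (h : (μ : Measure ℝ) ≤ Leb01) :
    (μ : Measure ℝ) (Icc (0 : ℝ) 1)ᶜ = 0 := by
  refine le_antisymm ((h _).trans ?_) zero_le
  rw [Leb01, Measure.restrict_apply measurableSet_Icc.compl]; simp

lemma integral_eq_dens_mul (h : (μ : Measure ℝ) ≤ Leb01) (f : ℝ → ℝ) :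
    ∫ x, f x ∂(μ : Measure ℝ) = ∫ x, dens μ x * f x ∂Leb01 := by
  have hac : (μ : Measure ℝ) ≪ volume :=
    Measure.absolutelyContinuous_of_le (h.trans leb01_le_volume)
  have h2 : (μ : Measure ℝ).restrict (Icc (0 : ℝ) 1) = μ :=
    Measure.restrict_eq_self_of_ae_mem (measure_compl_Icc h)
  conv_lhs => rw [← h2]
  unfold Leb01
  rw [← setIntegral_rnDeriv_smul hac measurableSet_Icc]
  rfl

lemma integrable_leb01_of_bound {f : ℝ → ℝ} (hf : Measurable f) {C : ℝ}
    (hC : ∀ᵐ x ∂Leb01, |f x| ≤ C) : Integrable f Leb01 :=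
  Integrable.of_bound hf.aestronglyMeasurable C hC

lemma integral_leb01_const (c : ℝ) : ∫ _, c ∂Leb01 = c := by
  simp [Leb01]

/-- The total binary entropy of the density. -/
def ent (μ : FiniteMeasure ℝ) : ℝ := ∫ x, binEntropy (dens μ x) ∂Leb01

lemma measurable_binEntropy : Measurable binEntropy := binEntropy_continuous.measurable

lemma integrable_binEntropy_dens (h : (μ : Measure ℝ) ≤ Leb01) :
    Integrable (fun x => binEntropy (dens μ x)) Leb01 := by
  refine integrable_leb01_of_bound (C := log 2)
    (measurable_binEntropy.comp (measurable_dens μ)) ?_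
  filter_upwards [dens_le_one h] with x hx
  rw [abs_of_nonneg (binEntropy_nonneg (dens_nonneg μ x) hx)]
  exact binEntropy_le_log_two

lemma ent_le_log_two (h : (μ : Measure ℝ) ≤ Leb01) : ent μ ≤ log 2 := by
  have := integral_mono (integrable_binEntropy_dens h) (integrable_const (log 2))
    fun x => binEntropy_le_log_two
  rwa [integral_leb01_const] at this

lemma integrable_dens_mul (h : (μ : Measure ℝ) ≤ Leb01) {f : ℝ → ℝ} (hf : Integrable f Leb01) :
    Integrable (fun x => dens μ x * f x) Leb01 := by
  refine hf.bdd_mul (c := 1) (measurable_dens μ).aestronglyMeasurable ?_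
  filter_upwards [dens_le_one h] with x hx
  rwa [norm_eq_abs, abs_of_nonneg (dens_nonneg μ x)]

lemma integrable_softplus {f : ℝ → ℝ} (hf : Integrable f Leb01) :
    Integrable (fun x => softplus (f x)) Leb01 := by
  refine Integrable.mono' ((hf.abs).add (integrable_const (log 2)))
    (continuous_softplus.comp_aestronglyMeasurable hf.aestronglyMeasurable)
    (Eventually.of_forall fun x => ?_)
  rw [norm_eq_abs, abs_of_nonneg (softplus_nonneg _)]
  have := softplus_le_add (f x) 0
  simp only [sub_zero] at this
  refine this.trans_eq ?_
  simp only [Pi.add_apply, softplus, exp_zero, one_add_one_eq_two, add_comm]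

lemma integrable_bcf (f : ℝ →ᵇ ℝ) (ν : Measure ℝ) [IsFiniteMeasure ν] : Integrable f ν :=
  BoundedContinuousFunction.integrable ν f

/-- The cumulant functional dual to `-ent`. -/
def cumulant (f : ℝ → ℝ) : ℝ := ∫ x, softplus (f x) ∂Leb01

lemma integral_add_ent_le (h : (μ : Measure ℝ) ≤ Leb01) {f : ℝ → ℝ} (hf : Integrable f Leb01) :
    ∫ x, f x ∂(μ : Measure ℝ) + ent μ ≤ cumulant f := by
  rw [integral_eq_dens_mul h, ent, cumulant,
    ← integral_add (integrable_dens_mul h hf) (integrable_binEntropy_dens h)]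
  refine integral_mono_ae ((integrable_dens_mul h hf).add (integrable_binEntropy_dens h))
    (integrable_softplus hf) ?_
  filter_upwards [dens_le_one h] with x hx using mul_add_binEntropy_le (dens_nonneg μ x) hx _

lemma exists_bcf_cumulant_le (h : (μ : Measure ℝ) ≤ Leb01) {ε : ℝ} (hε : 0 < ε) :
    ∃ f : ℝ →ᵇ ℝ, cumulant f ≤ ∫ x, f x ∂(μ : Measure ℝ) + ent μ + ε := by
  obtain ⟨δ, hδ0, hδ1, hδ⟩ : ∃ δ : ℝ, 0 < δ ∧ δ < 1 / 2 ∧ -(ε / 2) ≤ log (1 - 2 * δ) := by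
    have hc : ContinuousAt (fun δ : ℝ => log (1 - 2 * δ)) 0 :=
      ContinuousAt.log (by fun_prop) (by simp)
    have h1 : ∀ᶠ δ in nhds (0 : ℝ), -(ε / 2) < log (1 - 2 * δ) :=
      hc.eventually (lt_mem_nhds (by simp; linarith))
    have h2 : ∀ᶠ δ in nhds (0 : ℝ), δ < 1 / 2 := gt_mem_nhds (by norm_num)
    obtain ⟨δ, ⟨ha, hb⟩, hc⟩ := (((h1.and h2).filter_mono nhdsWithin_le_nhds).and
      (self_mem_nhdsWithin (a := (0 : ℝ)) (s := Ioi 0))).exists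
    exact ⟨δ, hc, hb, ha.le⟩
  set g : ℝ → ℝ := fun x => (1 - 2 * δ) * dens μ x + δ with hg
  have hgm : Measurable g := ((measurable_dens μ).const_mul _).add_const _
  set f₀ : ℝ → ℝ := fun x => log (g x / (1 - g x)) with hf₀
  have hf₀m : Measurable f₀ := measurable_log.comp (hgm.div (measurable_const.sub hgm))
  have hgb : ∀ᵐ x ∂Leb01, δ ≤ g x ∧ g x ≤ 1 - δ := by
    filter_upwards [dens_le_one h] with x hx
    have := dens_nonneg μ x
    constructor <;> simp only [hg] <;> nlinarith
  have hf₀i : Integrable f₀ Leb01 := by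
    refine integrable_leb01_of_bound (C := 2 * -log δ) hf₀m ?_
    filter_upwards [hgb] with x hx
    have a0 : 0 < g x := by linarith
    have a1 : 0 < 1 - g x := by linarith
    simp only [hf₀]
    rw [log_div a0.ne' a1.ne']
    have b1 := log_le_log hδ0 hx.1
    have b2 := log_le_log hδ0 (by linarith : δ ≤ 1 - g x)
    have b3 : log (g x) ≤ 0 := log_nonpos a0.le (by linarith)
    have b4 : log (1 - g x) ≤ 0 := log_nonpos a1.le (by linarith)
    rw [abs_le]; constructor <;> linarith
  have key : cumulant f₀ ≤ ∫ x, f₀ x ∂(μ : Measure ℝ) + ent μ + ε / 2 := by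
    rw [integral_eq_dens_mul h, ent, cumulant,
      ← integral_add (integrable_dens_mul h hf₀i) (integrable_binEntropy_dens h)]
    conv_rhs => rw [← integral_leb01_const (ε / 2)]
    have hi : Integrable (fun x => dens μ x * f₀ x + binEntropy (dens μ x)) Leb01 :=
      (integrable_dens_mul h hf₀i).add (integrable_binEntropy_dens h)
    rw [← integral_add hi (integrable_const _)]
    refine integral_mono_ae (integrable_softplus hf₀i) (hi.add (integrable_const _)) ?_
    filter_upwards [dens_le_one h] with x hx
    have := neg_binEntropy_add_le (dens_nonneg μ x) hx hδ0 hδ1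
    simp only [hf₀, hg]
    linarith
  obtain ⟨f, hf, -⟩ := hf₀i.exists_boundedContinuous_integral_sub_le (half_pos (half_pos hε))
  refine ⟨f, ?_⟩
  have hfi := integrable_bcf f Leb01
  have hd : Integrable (fun x => |f₀ x - f x|) Leb01 := (hf₀i.sub hfi).abs
  have e1 : cumulant f ≤ cumulant f₀ + ∫ x, |f₀ x - f x| ∂Leb01 := by
    unfold cumulant
    rw [← integral_add (integrable_softplus hf₀i) hd]
    refine integral_mono (integrable_softplus hfi) ((integrable_softplus hf₀i).add hd) fun x => ?_
    have := softplus_le_add (f x) (f₀ x)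
    rwa [abs_sub_comm] at this
  have e2 : ∫ x, f₀ x ∂(μ : Measure ℝ) ≤
      ∫ x, f x ∂(μ : Measure ℝ) + ∫ x, |f₀ x - f x| ∂Leb01 := by
    rw [integral_eq_dens_mul h, integral_eq_dens_mul h, ← integral_add
      (integrable_dens_mul h hfi) hd]
    refine integral_mono_ae (integrable_dens_mul h hf₀i) ((integrable_dens_mul h hfi).add hd) ?_
    filter_upwards [dens_le_one h] with x hx
    have h0 := dens_nonneg μ x
    have := le_abs_self (f₀ x - f x)
    have := abs_nonneg (f₀ x - f x)
    nlinarith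
  have e3 : ∫ x, |f₀ x - f x| ∂Leb01 ≤ ε / 2 / 2 := hf
  linarith

end Subuniform

/-- Real-valued version of the rate function. -/
def rate (p : Dspace) : ℝ := 2 * log 2 - ent p.1.1 - ent p.1.2

lemma fst_le_leb01 (p : Dspace) : (p.1.1 : Measure ℝ) ≤ Leb01 := p.2.1
lemma snd_le_leb01 (p : Dspace) : (p.1.2 : Measure ℝ) ≤ Leb01 := p.2.2.1

lemma integral_entTerm_add {μ ν : FiniteMeasure ℝ} (hμ : (μ : Measure ℝ) ≤ Leb01)
    (hν : (ν : Measure ℝ) ≤ Leb01) :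
    ∫ x, (entTerm (dens μ x) + entTerm (dens ν x)) ∂Leb01 = 2 * log 2 - ent μ - ent ν := by
  have h1 := integrable_binEntropy_dens hμ
  have h2 := integrable_binEntropy_dens hν
  have h12 : Integrable (fun x => binEntropy (dens μ x) + binEntropy (dens ν x)) Leb01 := h1.add h2
  have h : ∀ x, entTerm (dens μ x) + entTerm (dens ν x) =
      2 * log 2 - (binEntropy (dens μ x) + binEntropy (dens ν x)) := fun x => by
    rw [entTerm_eq, entTerm_eq]; ring
  simp only [h]
  rw [integral_sub (integrable_const _) h12, integral_add h1 h2, integral_leb01_const,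
    ent, ent]
  ring

lemma H321_eq_rate (p : Dspace) : H321 p = (rate p : EReal) :=
  congrArg _ (integral_entTerm_add (fst_le_leb01 p) (snd_le_leb01 p))

lemma rate_nonneg (p : Dspace) : 0 ≤ rate p := by
  have := ent_le_log_two (fst_le_leb01 p)
  have := ent_le_log_two (snd_le_leb01 p)
  unfold rate; linarith

/-- The affine functionals of which the rate function is the supremum. -/
def tilt (f g : ℝ →ᵇ ℝ) (p : Dspace) : ℝ :=
  ∫ x, f x ∂(p.1.1 : Measure ℝ) + ∫ x, g x ∂(p.1.2 : Measure ℝ)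

lemma continuous_tilt (f g : ℝ →ᵇ ℝ) : Continuous (tilt f g) := by
  unfold tilt
  have h : ∀ f : ℝ →ᵇ ℝ, Continuous fun μ : FiniteMeasure ℝ => ∫ x, f x ∂(μ : Measure ℝ) :=
    fun f => continuous_iff_continuousAt.2 fun μ =>
      (FiniteMeasure.tendsto_iff_forall_integral_tendsto.1 tendsto_id) f
  have hs : Continuous (fun p : Dspace => p.1) := continuous_subtype_val
  exact ((h f).comp (continuous_fst.comp hs)).add ((h g).comp (continuous_snd.comp hs))

lemma tilt_sub_le_rate (f g : ℝ →ᵇ ℝ) (p : Dspace) :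
    tilt f g p - cumulant f - cumulant g + 2 * log 2 ≤ rate p := by
  have h1 := integral_add_ent_le (fst_le_leb01 p) (integrable_bcf f Leb01)
  have h2 := integral_add_ent_le (snd_le_leb01 p) (integrable_bcf g Leb01)
  unfold tilt rate; linarith

lemma exists_rate_lt_tilt (p : Dspace) {c : ℝ} (hc : c < rate p) :
    ∃ f g : ℝ →ᵇ ℝ, c < tilt f g p - cumulant f - cumulant g + 2 * log 2 := by
  have hε : 0 < (rate p - c) / 3 := by linarith
  obtain ⟨f, hf⟩ := exists_bcf_cumulant_le (fst_le_leb01 p) hε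
  obtain ⟨g, hg⟩ := exists_bcf_cumulant_le (snd_le_leb01 p) hε
  refine ⟨f, g, ?_⟩
  unfold tilt rate at *
  linarith

lemma lowerSemicontinuous_H321 : LowerSemicontinuous H321 := by
  intro p y hy
  rw [H321_eq_rate] at hy
  obtain ⟨c, hyc, hcp⟩ := EReal.lt_iff_exists_real_btwn.1 hy
  obtain ⟨f, g, h⟩ := exists_rate_lt_tilt p (EReal.coe_lt_coe_iff.1 hcp)
  have hcont : Continuous fun q => tilt f g q - cumulant f - cumulant g + 2 * log 2 := by
    have := continuous_tilt f g
    fun_prop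
  filter_upwards [hcont.continuousAt.eventually (lt_mem_nhds h)] with q hq
  rw [H321_eq_rate]
  exact hyc.trans (EReal.coe_lt_coe_iff.2 (hq.trans_le (tilt_sub_le_rate f g q)))

lemma continuousOn_measureReal {E : Set ℝ} (hE : MeasurableSet E) :
    ContinuousOn (fun μ : FiniteMeasure ℝ => (μ : Measure ℝ).real E)
      {μ | (μ : Measure ℝ) ≤ Leb01} := by
  refine continuousOn_of_uniform_approx_of_continuousOn fun u hu => ?_
  obtain ⟨ε, hε, hεu⟩ := Metric.mem_uniformity_dist.1 hu
  have hi : Integrable (E.indicator fun _ => (1 : ℝ)) Leb01 := (integrable_const 1).indicator hE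
  obtain ⟨g, hg, hgi⟩ := hi.exists_boundedContinuous_integral_sub_le (half_pos hε)
  refine ⟨fun μ => ∫ x, g x ∂(μ : Measure ℝ), ?_, fun μ hμ => hεu ?_⟩
  · exact (continuous_iff_continuousAt.2 fun μ =>
      (FiniteMeasure.tendsto_iff_forall_integral_tendsto.1 tendsto_id) g).continuousOn
  · have hμ' : (μ : Measure ℝ) ≤ Leb01 := hμ
    have e : (μ : Measure ℝ).real E = ∫ x, E.indicator (fun _ => (1 : ℝ)) x ∂(μ : Measure ℝ) := by
      rw [integral_indicator_const _ hE]; simp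
    rw [e, dist_eq_norm, ← integral_sub (hi.mono_measure hμ') (hgi.mono_measure hμ')]
    calc _ ≤ ∫ x, ‖E.indicator (fun _ => (1 : ℝ)) x - g x‖ ∂(μ : Measure ℝ) :=
          norm_integral_le_integral_norm _
      _ ≤ ∫ x, ‖E.indicator (fun _ => (1 : ℝ)) x - g x‖ ∂Leb01 :=
          integral_mono_measure hμ' (Eventually.of_forall fun _ => norm_nonneg _)
            (hi.sub hgi).norm
      _ < ε := by linarith

lemma le_leb01_of_forall_lintegral_le {μ : FiniteMeasure ℝ}
    (h : ∀ f : ℝ →ᵇ ℝ≥0, ∫⁻ x, f x ∂(μ : Measure ℝ) ≤ ∫⁻ x, f x ∂Leb01) :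
    (μ : Measure ℝ) ≤ Leb01 := by
  refine Measure.le_iff.2 fun s hs => ?_
  rw [hs.measure_eq_iSup_isClosed_of_ne_top (measure_ne_top _ _)]
  refine iSup₂_le fun F hFs => iSup_le fun hF => ?_
  refine le_trans ?_ (measure_mono hFs)
  exact le_of_tendsto_of_tendsto' (HasOuterApproxClosed.tendsto_lintegral_apprSeq hF _)
    (HasOuterApproxClosed.tendsto_lintegral_apprSeq hF _) fun n => h _

lemma isClosed_le_leb01 : IsClosed {μ : FiniteMeasure ℝ | (μ : Measure ℝ) ≤ Leb01} := by
  have : {μ : FiniteMeasure ℝ | (μ : Measure ℝ) ≤ Leb01} =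
      ⋂ f : ℝ →ᵇ ℝ≥0, {μ : FiniteMeasure ℝ | ∫⁻ x, f x ∂(μ : Measure ℝ) ≤ ∫⁻ x, f x ∂Leb01} := by
    ext μ
    rw [mem_iInter]
    exact ⟨fun h f => lintegral_mono' h le_rfl, le_leb01_of_forall_lintegral_le⟩
  rw [this]
  refine isClosed_iInter fun f => isClosed_le ?_ continuous_const
  exact continuous_iff_continuousAt.2 fun μ =>
    (FiniteMeasure.tendsto_iff_forall_lintegral_tendsto.1 tendsto_id) f

lemma isCompact_le_leb01 : IsCompact {μ : FiniteMeasure ℝ | (μ : Measure ℝ) ≤ Leb01} := by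
  refine IsCompact.of_isClosed_subset
    (isCompact_setOfPred_finiteMeasure_le_of_isCompact (E := ℝ) 1 (isCompact_Icc (a := 0) (b := 1)))
    isClosed_le_leb01 fun μ hμ => ⟨?_, ?_⟩
  · have := (show (μ : Measure ℝ) ≤ Leb01 from hμ) univ
    rw [Leb01, Measure.restrict_apply_univ, Real.volume_Icc] at this
    rw [← ENNReal.coe_le_coe, FiniteMeasure.ennreal_mass]
    simpa using this
  · rw [← ENNReal.coe_eq_zero, FiniteMeasure.ennreal_coeFn_eq_coeFn_toMeasure]
    exact measure_compl_Icc hμ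

lemma isCompact_memD :
    IsCompact {p : FiniteMeasure ℝ × FiniteMeasure ℝ | MemD (p.1 : Measure ℝ) p.2} := by
  set T : Set (FiniteMeasure ℝ × FiniteMeasure ℝ) :=
    {μ : FiniteMeasure ℝ | (μ : Measure ℝ) ≤ Leb01} ×ˢ
      {μ : FiniteMeasure ℝ | (μ : Measure ℝ) ≤ Leb01} with hT
  have hTc : IsCompact T := isCompact_le_leb01.prod isCompact_le_leb01
  have hTcl : IsClosed T := isClosed_le_leb01.prod isClosed_le_leb01
  refine hTc.of_isClosed_subset ?_ fun p hp => ⟨hp.1, hp.2.1⟩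
  have : {p : FiniteMeasure ℝ × FiniteMeasure ℝ | MemD (p.1 : Measure ℝ) p.2} =
      {p | p.1.mass = p.2.mass} ∩ ⋂ x : ℝ, {p ∈ T | (p.1 : Measure ℝ).real (Icc 0 x) ≤
        (p.2 : Measure ℝ).real (Icc 0 x)} := by
    ext p
    simp only [MemD, mem_ofPred_eq, mem_inter_iff, mem_iInter]
    rw [← FiniteMeasure.ennreal_mass, ← FiniteMeasure.ennreal_mass, ENNReal.coe_inj]
    have hle : ∀ x, ((p.1 : Measure ℝ).real (Icc 0 x) ≤ (p.2 : Measure ℝ).real (Icc 0 x)) ↔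
        (p.1 : Measure ℝ) (Icc 0 x) ≤ (p.2 : Measure ℝ) (Icc 0 x) := fun x =>
      ENNReal.toReal_le_toReal (measure_ne_top _ _) (measure_ne_top _ _)
    simp only [hle]
    exact ⟨fun h => ⟨h.2.2.1, fun x => ⟨⟨h.1, h.2.1⟩, h.2.2.2 x⟩⟩,
      fun h => ⟨(h.2 0).1.1, (h.2 0).1.2, h.1, fun x => (h.2 x).2⟩⟩
  rw [this]
  have c1 : ∀ x : ℝ, ContinuousOn (fun p : FiniteMeasure ℝ × FiniteMeasure ℝ =>
      (p.1 : Measure ℝ).real (Icc 0 x)) T := fun x =>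
    (continuousOn_measureReal measurableSet_Icc).comp continuousOn_fst fun p hp => hp.1
  have c2 : ∀ x : ℝ, ContinuousOn (fun p : FiniteMeasure ℝ × FiniteMeasure ℝ =>
      (p.2 : Measure ℝ).real (Icc 0 x)) T := fun x =>
    (continuousOn_measureReal measurableSet_Icc).comp continuousOn_snd fun p hp => hp.2
  exact (isClosed_eq (by fun_prop) (by fun_prop)).inter
    (isClosed_iInter fun x => hTcl.isClosed_le (c1 x) (c2 x))

instance : CompactSpace Dspace := isCompact_iff_compactSpace.1 isCompact_memD

/-- The distribution function of the first measure. -/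
def cdf₁ (p : Dspace) (x : ℝ) : ℝ := (p.1.1 : Measure ℝ).real (Icc 0 x)

/-- The distribution function of the second measure. -/
def cdf₂ (p : Dspace) (x : ℝ) : ℝ := (p.1.2 : Measure ℝ).real (Icc 0 x)

lemma continuous_cdf₁ (x : ℝ) : Continuous fun p => cdf₁ p x :=
  (continuousOn_measureReal (measurableSet_Icc (a := 0) (b := x))).comp_continuous
    (f := fun p : Dspace => p.1.1) (continuous_fst.comp continuous_subtype_val) fst_le_leb01

lemma continuous_cdf₂ (x : ℝ) : Continuous fun p => cdf₂ p x :=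
  (continuousOn_measureReal (measurableSet_Icc (a := 0) (b := x))).comp_continuous
    (f := fun p : Dspace => p.1.2) (continuous_snd.comp continuous_subtype_val) snd_le_leb01

lemma eq_of_forall_real_Icc_eq {μ ν : FiniteMeasure ℝ} (hμ : (μ : Measure ℝ) ≤ Leb01)
    (hν : (ν : Measure ℝ) ≤ Leb01)
    (h : ∀ x ∈ Icc (0 : ℝ) 1, (μ : Measure ℝ).real (Icc 0 x) = (ν : Measure ℝ).real (Icc 0 x)) :
    μ = ν := by
  refine Subtype.ext (Measure.ext_of_Iic (μ : Measure ℝ) (ν : Measure ℝ) fun a => ?_)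
  have key : ∀ {ξ : FiniteMeasure ℝ}, (ξ : Measure ℝ) ≤ Leb01 →
      (ξ : Measure ℝ) (Iic a) = (ξ : Measure ℝ) (Icc 0 (min a 1)) := fun {ξ} hξ => by
    rw [← measure_inter_add_sdiff (Iic a) (measurableSet_Icc (a := (0 : ℝ)) (b := 1)),
      measure_mono_null (s := Iic a \ Icc 0 1) (fun x hx => hx.2) (measure_compl_Icc hξ),
      add_zero]
    congr 1
    ext x
    simp only [mem_inter_iff, mem_Iic, mem_Icc, le_min_iff]
    tauto
  rw [key hμ, key hν]
  rcases lt_or_ge a 0 with ha | ha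
  · have : Icc (0 : ℝ) (min a 1) = ∅ := Icc_eq_empty fun hh =>
        absurd (hh.trans (min_le_left _ _)) ha.not_ge
    simp [this]
  · exact (ENNReal.toReal_eq_toReal_iff' (measure_ne_top _ _) (measure_ne_top _ _)).1
      (h _ ⟨le_min ha zero_le_one, min_le_right _ _⟩)

lemma exists_cdf_ball_subset {O : Set Dspace} (hO : IsOpen O) {p : Dspace} (hp : p ∈ O) :
    ∃ δ > 0, ∀ q : Dspace, (∀ x ∈ Icc (0 : ℝ) 1, |cdf₁ q x - cdf₁ p x| ≤ δ) →
      (∀ x ∈ Icc (0 : ℝ) 1, |cdf₂ q x - cdf₂ p x| ≤ δ) → q ∈ O := by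
  let t : Ioi (0 : ℝ) → Set Dspace := fun δ => ⋂ x ∈ Icc (0 : ℝ) 1,
    {q | |cdf₁ q x - cdf₁ p x| ≤ δ} ∩ {q | |cdf₂ q x - cdf₂ p x| ≤ δ}
  have htc : ∀ δ, IsClosed (t δ) := fun δ => by
    refine isClosed_biInter fun x _ => IsClosed.inter (isClosed_le ?_ continuous_const)
      (isClosed_le ?_ continuous_const)
    · exact ((continuous_cdf₁ x).sub continuous_const).abs
    · exact ((continuous_cdf₂ x).sub continuous_const).abs
  have hmono : ∀ {a b : Ioi (0 : ℝ)}, a ≤ b → t a ⊆ t b := fun {a b} hab =>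
    iInter₂_mono fun x _ q hq => ⟨hq.1.trans (Subtype.coe_le_coe.2 hab),
      hq.2.trans (Subtype.coe_le_coe.2 hab)⟩
  have hdir : Directed (· ⊇ ·) t := fun a b =>
    ⟨min a b, hmono (min_le_left a b), hmono (min_le_right a b)⟩
  have hemp : Oᶜ ∩ ⋂ δ, t δ = ∅ := by
    refine eq_empty_iff_forall_notMem.2 fun q hq => hq.1 ?_
    have hq2 : ∀ x ∈ Icc (0 : ℝ) 1, ∀ δ > 0,
        |cdf₁ q x - cdf₁ p x| ≤ δ ∧ |cdf₂ q x - cdf₂ p x| ≤ δ :=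
      fun x hx δ hδ => mem_iInter₂.1 (mem_iInter.1 hq.2 ⟨δ, hδ⟩) x hx
    have hz : ∀ {u v : ℝ}, (∀ δ > 0, |u - v| ≤ δ) → u = v := fun h =>
      sub_eq_zero.1 (abs_nonpos_iff.1 (le_of_forall_gt_imp_ge_of_dense fun δ hδ => h δ hδ))
    have : q = p := Subtype.ext (Prod.ext
      (eq_of_forall_real_Icc_eq (fst_le_leb01 q) (fst_le_leb01 p) fun x hx =>
        hz fun δ hδ => (hq2 x hx δ hδ).1)
      (eq_of_forall_real_Icc_eq (snd_le_leb01 q) (snd_le_leb01 p) fun x hx =>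
        hz fun δ hδ => (hq2 x hx δ hδ).2))
    rwa [this]
  have : Nonempty (Ioi (0 : ℝ)) := ⟨⟨1, mem_Ioi.2 one_pos⟩⟩
  obtain ⟨δ, hδ⟩ := hO.isClosed_compl.isCompact.elim_directed_family_closed t htc hemp hdir
  refine ⟨δ, δ.2, fun q h1 h2 => by_contra fun hq => ?_⟩
  exact (eq_empty_iff_forall_notMem.1 hδ q) ⟨hq, mem_iInter₂.2 fun x hx => ⟨h1 x hx, h2 x hx⟩⟩

/-- The integral of `f` over the `i`-th of `n` equal cells of the unit interval. -/
def cellInt (n : ℕ) (f : ℝ → ℝ) (i : ℕ) : ℝ :=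
  ∫ x in Icc ((i : ℝ) / n) (((i : ℝ) + 1) / n), f x

lemma cellInt_eq_intervalIntegral (n : ℕ) (f : ℝ → ℝ) (i : ℕ) :
    cellInt n f i = ∫ x in ((i : ℝ) / n)..(((i + 1 : ℕ) : ℝ) / n), f x := by
  have : (i : ℝ) / n ≤ ((i + 1 : ℕ) : ℝ) / n := by gcongr; simp
  rw [cellInt, intervalIntegral.integral_of_le this, integral_Icc_eq_integral_Ioc]
  push_cast
  rfl

lemma sum_cellInt {n : ℕ} (hn : 1 ≤ n) {f : ℝ → ℝ} (hf : Continuous f) :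
    ∑ i : Fin n, cellInt n f i = ∫ x, f x ∂Leb01 := by
  have hn' : (n : ℝ) ≠ 0 := by positivity
  rw [Fin.sum_univ_eq_sum_range (fun i => cellInt n f i) n]
  simp only [cellInt_eq_intervalIntegral]
  rw [intervalIntegral.sum_integral_adjacent_intervals (a := fun i : ℕ => (i : ℝ) / n)
    fun k _ => hf.intervalIntegrable _ _]
  simp only [Nat.cast_zero, zero_div, div_self hn']
  rw [intervalIntegral.integral_of_le zero_le_one, Leb01, integral_Icc_eq_integral_Ioc]

lemma integrableOn_cell (n : ℕ) (i : ℕ) {f : ℝ → ℝ} (hf : Continuous f) :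
    IntegrableOn f (Icc ((i : ℝ) / n) (((i : ℝ) + 1) / n)) :=
  hf.integrableOn_Icc

lemma cellInt_const {n : ℕ} (hn : 1 ≤ n) (i : ℕ) (c : ℝ) : cellInt n (fun _ => c) i = c / n := by
  have hn' : (n : ℝ) ≠ 0 := by positivity
  rw [cellInt_eq_intervalIntegral, intervalIntegral.integral_const, smul_eq_mul]
  push_cast
  field_simp
  ring

lemma softplus_mul_cellInt_le {n : ℕ} (hn : 1 ≤ n) {f : ℝ → ℝ} (hf : Continuous f) (i : ℕ) :
    softplus (n * cellInt n f i) ≤ n * cellInt n (fun x => softplus (f x)) i := by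
  have hn' : (0 : ℝ) < n := by positivity
  obtain ⟨r, h0, h1, h⟩ := exists_mul_add_binEntropy_eq (n * cellInt n f i)
  have h2 : cellInt n (fun x => r * f x + binEntropy r) i ≤ cellInt n (fun x => softplus (f x)) i :=
    setIntegral_mono (integrableOn_cell n i (by fun_prop))
      (integrableOn_cell n i (continuous_softplus.comp hf))
      fun x => mul_add_binEntropy_le h0 h1 (f x)
  have h3 : cellInt n (fun x => r * f x + binEntropy r) i =
      r * cellInt n f i + binEntropy r / n := by
    rw [← cellInt_const hn i]
    unfold cellInt
    rw [integral_add (integrableOn_cell n i (by fun_prop)) (integrableOn_cell n i (by fun_prop)),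
      integral_const_mul]
  rw [← h]
  calc r * (n * cellInt n f i) + binEntropy r = n * (r * cellInt n f i + binEntropy r / n) := by
        field_simp
    _ ≤ _ := by rw [← h3]; gcongr

lemma sum_exp_cellInt_le {n : ℕ} (hn : 1 ≤ n) {f : ℝ → ℝ} (hf : Continuous f) :
    ∑ A : Finset (Fin n), exp (n * ∑ a ∈ A, cellInt n f (a : ℕ)) ≤ exp (n * cumulant f) := by
  have e : ∀ A : Finset (Fin n), exp (n * ∑ a ∈ A, cellInt n f (a : ℕ)) =
      ∏ a ∈ A, exp (n * cellInt n f (a : ℕ)) := fun A => by rw [Finset.mul_sum, exp_sum]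
  calc ∑ A : Finset (Fin n), exp (n * ∑ a ∈ A, cellInt n f (a : ℕ))
      = ∏ a : Fin n, (1 + exp (n * cellInt n f (a : ℕ))) := by
        rw [Finset.prod_one_add, Finset.powerset_univ]
        exact Finset.sum_congr rfl fun A _ => e A
    _ = exp (∑ a : Fin n, softplus (n * cellInt n f (a : ℕ))) := by
        rw [exp_sum]
        refine Finset.prod_congr rfl fun a _ => ?_
        rw [softplus, exp_log (by positivity)]
    _ ≤ _ := by
        refine exp_le_exp.2 ?_
        rw [cumulant, ← sum_cellInt hn (f := fun x => softplus (f x)) (continuous_softplus.comp hf),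
          Finset.mul_sum]
        exact Finset.sum_le_sum fun a _ => softplus_mul_cellInt_le hn hf _

lemma integral_pi1 {n : ℕ} (σ : Equiv.Perm (Fin n)) {f : ℝ → ℝ} (hf : Continuous f) :
    ∫ x, f x ∂(pi1 σ) = ∑ a ∈ (rlmPair σ).1, cellInt n f (a : ℕ) := by
  exact integral_finsetSum_measure fun i _ => integrableOn_cell n (i : ℕ) hf

lemma integral_pi2 {n : ℕ} (σ : Equiv.Perm (Fin n)) {f : ℝ → ℝ} (hf : Continuous f) :
    ∫ x, f x ∂(pi2 σ) = ∑ b ∈ (rlmPair σ).2, cellInt n f (b : ℕ) := by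
  rw [pi2, integral_finsetSum_measure fun i _ => integrableOn_cell n _ hf, rlmPair,
    Finset.sum_image fun a _ b _ h => σ.injective h]
  rfl

lemma card_avoids321_le_exp {n : ℕ} (hn : 1 ≤ n) (f g : ℝ →ᵇ ℝ) (c : ℝ)
    (P : Equiv.Perm (Fin n) → Prop)
    (hP : ∀ σ, Avoids321 σ → P σ → c ≤ ∫ x, f x ∂(pi1 σ) + ∫ x, g x ∂(pi2 σ)) :
    ((Finset.univ.filter fun σ : Equiv.Perm (Fin n) => Avoids321 σ ∧ P σ).card : ℝ) ≤
      exp (n * (cumulant f + cumulant g - c)) := by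
  set S := Finset.univ.filter fun σ : Equiv.Perm (Fin n) => Avoids321 σ ∧ P σ with hS
  let w : Finset (Fin n) × Finset (Fin n) → ℝ := fun p =>
    exp (n * ∑ a ∈ p.1, cellInt n f (a : ℕ)) * exp (n * ∑ b ∈ p.2, cellInt n g (b : ℕ))
  have h1 : ∀ σ ∈ S, exp (n * c) ≤ w (rlmPair σ) := fun σ hσ => by
    obtain ⟨-, h, h'⟩ := Finset.mem_filter.1 hσ
    simp only [w]
    rw [← exp_add, ← mul_add, ← integral_pi1 σ f.continuous, ← integral_pi2 σ g.continuous]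
    exact exp_le_exp.2 (mul_le_mul_of_nonneg_left (hP σ h h') (by positivity))
  have h2 : (S.card : ℝ) * exp (n * c) ≤ exp (n * cumulant f) * exp (n * cumulant g) := by
    calc (S.card : ℝ) * exp (n * c) = ∑ _σ ∈ S, exp (n * c) := by simp
      _ ≤ ∑ σ ∈ S, w (rlmPair σ) := Finset.sum_le_sum h1
      _ = ∑ p ∈ S.image rlmPair, w p := (Finset.sum_image fun a ha b hb h =>
          rlmPair_injOn n (Finset.mem_filter.1 ha).2.1 (Finset.mem_filter.1 hb).2.1 h).symm
      _ ≤ ∑ p, w p := Finset.sum_le_sum_of_subset_of_nonneg (Finset.subset_univ _)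
          fun _ _ _ => by positivity
      _ = (∑ A : Finset (Fin n), exp (n * ∑ a ∈ A, cellInt n f (a : ℕ))) *
          ∑ B : Finset (Fin n), exp (n * ∑ b ∈ B, cellInt n g (b : ℕ)) := by
        rw [Fintype.sum_prod_type, Finset.sum_mul_sum]
      _ ≤ _ := mul_le_mul (sum_exp_cellInt_le hn f.continuous)
          (sum_exp_cellInt_le hn g.continuous) (by positivity) (by positivity)
  rw [mul_sub, mul_add, exp_sub, exp_add, le_div_iff₀ (exp_pos _)]
  exact h2

lemma mul_log_sub_le_log_factorial (k : ℕ) : k * log k - k ≤ log (k.factorial : ℝ) := by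
  induction k with
  | zero => simp
  | succ k ih =>
    rw [Nat.factorial_succ, Nat.cast_mul, log_mul (by positivity) (by positivity)]
    rcases k.eq_zero_or_pos with rfl | hk
    · simp
    have hk' : (0 : ℝ) < k := by positivity
    have h := log_le_sub_one_of_pos (div_pos (by positivity : (0 : ℝ) < k + 1) hk')
    rw [log_div (by positivity) hk'.ne'] at h
    have h2 : k * (((k : ℝ) + 1) / k - 1) = 1 := by field_simp; ring
    have h3 := mul_le_mul_of_nonneg_left h hk'.le
    push_cast
    nlinarith

lemma log_factorial_le (k : ℕ) :
    log (k.factorial : ℝ) ≤ k * log k - k + log (k + 1) + 1 := by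
  rcases k.eq_zero_or_pos with rfl | hk
  · simp
  refine le_trans (b := k * log k - k + log k + 1) ?_ ?_
  · induction k, hk using Nat.le_induction with
    | base => simp
    | succ k hk ih =>
      rw [Nat.factorial_succ, Nat.cast_mul, log_mul (by positivity) (by positivity)]
      have hk' : (0 : ℝ) < k := by exact_mod_cast hk
      have h := log_le_sub_one_of_pos (div_pos hk' (by positivity : (0 : ℝ) < k + 1))
      rw [log_div hk'.ne' (by positivity)] at h
      have h2 : ((k : ℝ) + 1) * (k / (k + 1) - 1) = -1 := by field_simp; ring
      have h3 := mul_le_mul_of_nonneg_left h (by positivity : (0 : ℝ) ≤ k + 1)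
      push_cast
      nlinarith
  · have : log (k : ℝ) ≤ log (k + 1) := log_le_log (by positivity) (by linarith)
    linarith

lemma mul_binEntropy_div_le_log_choose {m a : ℕ} (hm : 0 < m) (ha : a ≤ m) :
    m * binEntropy ((a : ℝ) / m) - (2 * log (m + 1) + 2) ≤ log (m.choose a : ℝ) := by
  have hm' : (0 : ℝ) < m := by positivity
  obtain ⟨b, rfl⟩ := Nat.exists_eq_add_of_le ha
  have hf : (((a + b).choose a : ℕ) : ℝ) * a.factorial * b.factorial = (a + b).factorial := by
    have := Nat.choose_mul_factorial_mul_factorial ha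
    rw [Nat.add_sub_cancel_left] at this
    exact_mod_cast this
  have hc : (0 : ℝ) < ((a + b).choose a : ℕ) := by
    exact_mod_cast Nat.choose_pos (Nat.le_add_right a b)
  have hl := congrArg log hf
  rw [log_mul (by positivity) (by positivity), log_mul hc.ne' (by positivity)] at hl
  have h1 := mul_log_sub_le_log_factorial (a + b)
  have h2 := log_factorial_le a
  have h3 := log_factorial_le b
  have h4 : log ((a : ℝ) + 1) ≤ log (((a + b : ℕ) : ℝ) + 1) :=
    log_le_log (by positivity) (by push_cast; linarith [(b.cast_nonneg : (0 : ℝ) ≤ b)])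
  have h5 : log ((b : ℝ) + 1) ≤ log (((a + b : ℕ) : ℝ) + 1) :=
    log_le_log (by positivity) (by push_cast; linarith [(a.cast_nonneg : (0 : ℝ) ≤ a)])
  have key : ∀ x : ℕ, ((a + b : ℕ) : ℝ) * ((x : ℝ) / (a + b : ℕ) * log ((x : ℝ) / (a + b : ℕ))) =
      x * log x - x * log (a + b : ℕ) := fun x => by
    rcases x.eq_zero_or_pos with rfl | hx
    · simp
    · rw [log_div (by positivity) hm'.ne']
      field_simp
  have e : 1 - (a : ℝ) / (a + b : ℕ) = (b : ℝ) / (a + b : ℕ) := by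
    field_simp; push_cast; ring
  have h6 : ((a + b : ℕ) : ℝ) * binEntropy ((a : ℝ) / (a + b : ℕ)) =
      (a + b : ℕ) * log (a + b : ℕ) - a * log a - b * log b := by
    have k1 := key a
    have k2 := key b
    unfold binEntropy
    rw [e]
    simp only [log_inv]
    push_cast at *
    linear_combination -k1 - k2
  rw [h6]
  push_cast at *
  linarith

section Distribution

variable {μ : FiniteMeasure ℝ}

lemma real_Icc_sub (μ : FiniteMeasure ℝ) {x y : ℝ} (hx : 0 ≤ x) (hxy : x ≤ y) :
    (μ : Measure ℝ).real (Icc 0 y) - (μ : Measure ℝ).real (Icc 0 x) =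
      (μ : Measure ℝ).real (Ioc x y) := by
  rw [← Icc_union_Ioc_eq_Icc hx hxy, measureReal_union _ measurableSet_Ioc]
  · ring
  · exact disjoint_left.2 fun z hz hz' => hz'.1.not_ge hz.2

lemma real_Icc_sub_le (h : (μ : Measure ℝ) ≤ Leb01) {x y : ℝ} (hx : 0 ≤ x) (hxy : x ≤ y) :
    (μ : Measure ℝ).real (Icc 0 y) - (μ : Measure ℝ).real (Icc 0 x) ≤ y - x := by
  rw [real_Icc_sub μ hx hxy]
  refine ENNReal.toReal_le_of_le_ofReal (by linarith) ?_
  rw [← Real.volume_Ioc]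
  exact (h.trans leb01_le_volume) _

lemma abs_real_Icc_sub_le (h : (μ : Measure ℝ) ≤ Leb01) {x y : ℝ} (hx : 0 ≤ x) (hy : 0 ≤ y) :
    |(μ : Measure ℝ).real (Icc 0 x) - (μ : Measure ℝ).real (Icc 0 y)| ≤ |x - y| := by
  wlog hxy : y ≤ x generalizing x y
  · rw [abs_sub_comm, abs_sub_comm x]; exact this hy hx (le_of_not_ge hxy)
  rw [abs_of_nonneg, abs_of_nonneg (by linarith)]
  · exact real_Icc_sub_le h hy hxy
  · rw [real_Icc_sub μ hy hxy]; exact measureReal_nonneg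

lemma real_Icc_zero (h : (μ : Measure ℝ) ≤ Leb01) : (μ : Measure ℝ).real (Icc 0 0) = 0 := by
  have : (μ : Measure ℝ) (Icc 0 0) ≤ 0 := by
    refine ((h.trans leb01_le_volume) _).trans_eq ?_
    simp
  rw [Measure.real, le_antisymm this zero_le, ENNReal.toReal_zero]

lemma real_Icc_of_one_le (h : (μ : Measure ℝ) ≤ Leb01) {x : ℝ} (hx : 1 ≤ x) :
    (μ : Measure ℝ).real (Icc 0 x) = (μ : Measure ℝ).real univ := by
  refine measureReal_congr (eventuallyEq_univ.2 ?_)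
  refine measure_mono_null (compl_subset_compl.2 (Icc_subset_Icc_right hx)) (measure_compl_Icc h)

lemma real_Icc_le_one (h : (μ : Measure ℝ) ≤ Leb01) (x : ℝ) :
    (μ : Measure ℝ).real (Icc 0 x) ≤ 1 := by
  refine ENNReal.toReal_le_of_le_ofReal zero_le_one ((h _).trans ?_)
  refine (measure_mono (subset_univ _)).trans_eq ?_
  simp [Leb01]

lemma ent_nonneg (h : (μ : Measure ℝ) ≤ Leb01) : 0 ≤ ent μ := by
  refine integral_nonneg_of_ae ?_
  filter_upwards [dens_le_one h] with x hx using binEntropy_nonneg (dens_nonneg μ x) hx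

lemma cellInt_binEntropy_le (h : (μ : Measure ℝ) ≤ Leb01) {K j : ℕ} (hj : j < K) :
    K * cellInt K (fun x => binEntropy (dens μ x)) j ≤
      binEntropy (K * ((μ : Measure ℝ).real (Icc 0 (((j + 1 : ℕ) : ℝ) / K)) -
        (μ : Measure ℝ).real (Icc 0 ((j : ℝ) / K)))) := by
  have hK : (0 : ℝ) < K := by exact_mod_cast (Nat.zero_le j).trans_lt hj
  set c : Set ℝ := Icc ((j : ℝ) / K) (((j : ℝ) + 1) / K) with hc
  have hle : (j : ℝ) / K ≤ ((j : ℝ) + 1) / K := by gcongr; linarith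
  have hvol : volume c = ENNReal.ofReal (1 / K) := by
    rw [hc, Real.volume_Icc]; congr 1; ring
  have hvolr : (volume : Measure ℝ).real c = 1 / K := by
    rw [Measure.real, hvol, ENNReal.toReal_ofReal (by positivity)]
  have hsub : c ⊆ Icc 0 1 := Icc_subset_Icc (by positivity) (by
    rw [div_le_one hK]; exact_mod_cast hj)
  have hres : volume.restrict c ≤ Leb01 := Measure.restrict_mono hsub le_rfl
  have hd : ∀ᵐ x ∂(volume.restrict c), dens μ x ∈ Icc (0 : ℝ) 1 :=
    ae_mono hres ((dens_le_one h).mono fun x hx => ⟨dens_nonneg μ x, hx⟩)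
  have hdi : Integrable (dens μ) Leb01 := by
    simpa using integrable_dens_mul h (integrable_const (1 : ℝ))
  have hJ := strictConcave_binEntropy.concaveOn.le_map_set_average (μ := volume) (t := c)
    (f := dens μ) binEntropy_continuous.continuousOn isClosed_Icc
    (by rw [hvol]; simp [hK]) (by rw [hvol]; simp) hd (hdi.mono_measure hres)
    ((integrable_binEntropy_dens h).mono_measure hres)
  rw [setAverage_eq, setAverage_eq, hvolr, smul_eq_mul, smul_eq_mul, one_div, inv_inv] at hJ
  have hint : ∫ x in c, dens μ x = (μ : Measure ℝ).real (Icc 0 (((j + 1 : ℕ) : ℝ) / K)) -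
        (μ : Measure ℝ).real (Icc 0 ((j : ℝ) / K)) := by
    push_cast
    rw [real_Icc_sub μ (by positivity) hle, hc, integral_Icc_eq_integral_Ioc]
    exact Measure.setIntegral_toReal_rnDeriv
      (Measure.absolutelyContinuous_of_le (h.trans leb01_le_volume)) _
  rw [hint] at hJ
  exact hJ

lemma mul_ent_le_sum (h : (μ : Measure ℝ) ≤ Leb01) {K : ℕ} (hK : 1 ≤ K) :
    K * ent μ ≤ ∑ j ∈ Finset.range K,
      binEntropy (K * ((μ : Measure ℝ).real (Icc 0 (((j + 1 : ℕ) : ℝ) / K)) -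
        (μ : Measure ℝ).real (Icc 0 ((j : ℝ) / K)))) := by
  refine le_trans (le_of_eq ?_) (Finset.sum_le_sum fun j hj =>
    cellInt_binEntropy_le h (Finset.mem_range.1 hj))
  have hK' : (K : ℝ) ≠ 0 := by positivity
  rw [← Finset.mul_sum, ent]
  congr 1
  simp only [cellInt_eq_intervalIntegral]
  have hi : IntegrableOn (fun x => binEntropy (dens μ x)) (Icc 0 1) volume :=
    integrable_binEntropy_dens h
  rw [intervalIntegral.sum_integral_adjacent_intervals (a := fun i : ℕ => (i : ℝ) / K)]
  · simp only [Nat.cast_zero, zero_div, div_self hK']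
    rw [intervalIntegral.integral_of_le zero_le_one, Leb01, integral_Icc_eq_integral_Ioc]
  · intro k hk
    rw [intervalIntegrable_iff_integrableOn_Icc_of_le (by gcongr; simp)]
    refine hi.mono_set (Icc_subset_Icc (by positivity) ?_)
    rw [div_le_one (by positivity)]
    exact_mod_cast hk

/-- The number of occupied sites among the first `k` of `K` blocks of size `m`. -/
def quota (μ : FiniteMeasure ℝ) (K m k : ℕ) : ℕ :=
  ⌊(K * (μ : Measure ℝ).real (Icc 0 ((k : ℝ) / K))) * m⌋₊

lemma monotone_quota (μ : FiniteMeasure ℝ) (K m : ℕ) : Monotone (quota μ K m) := by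
  intro a b hab
  unfold quota
  gcongr
  exact measure_ne_top _ _

lemma quota_zero (h : (μ : Measure ℝ) ≤ Leb01) (K m : ℕ) : quota μ K m 0 = 0 := by
  simp [quota, -Icc_self, real_Icc_zero h]

lemma quota_succ_le (h : (μ : Measure ℝ) ≤ Leb01) {K : ℕ} (hK : 1 ≤ K) (m k : ℕ) :
    quota μ K m (k + 1) ≤ quota μ K m k + m := by
  unfold quota
  rw [← Nat.floor_add_natCast (by positivity)]
  refine Nat.floor_le_floor ?_
  have hK' : (0 : ℝ) < K := by positivity
  have := real_Icc_sub_le h (x := (k : ℝ) / K) (y := ((k + 1 : ℕ) : ℝ) / K) (by positivity)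
    (by gcongr; simp)
  have e : ((k + 1 : ℕ) : ℝ) / K - (k : ℝ) / K = 1 / K := by push_cast; ring
  rw [e] at this
  have h2 := mul_le_mul_of_nonneg_left this hK'.le
  rw [mul_one_div_cancel hK'.ne'] at h2
  have h3 := mul_le_mul_of_nonneg_right h2 (Nat.cast_nonneg (α := ℝ) m)
  linarith

lemma quota_of_ge (h : (μ : Measure ℝ) ≤ Leb01) {K : ℕ} (hK : 1 ≤ K) (m : ℕ) {k : ℕ}
    (hk : K ≤ k) : quota μ K m k = ⌊(K * (μ : Measure ℝ).real univ) * m⌋₊ := by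
  rw [quota, real_Icc_of_one_le h]
  rw [one_le_div (by positivity)]
  exact_mod_cast hk

lemma tendsto_sum_binEntropy_quota (μ : FiniteMeasure ℝ) (K : ℕ) :
    Tendsto (fun m : ℕ => ∑ j ∈ Finset.range K,
      binEntropy (((quota μ K m (j + 1) - quota μ K m j : ℕ) : ℝ) / m)) atTop
      (nhds (∑ j ∈ Finset.range K,
      binEntropy (K * ((μ : Measure ℝ).real (Icc 0 (((j + 1 : ℕ) : ℝ) / K)) -
        (μ : Measure ℝ).real (Icc 0 ((j : ℝ) / K)))))) := by
  refine tendsto_finsetSum _ fun j _ => (binEntropy_continuous.tendsto _).comp ?_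
  have hq : ∀ k : ℕ, Tendsto (fun m : ℕ => (quota μ K m k : ℝ) / m) atTop
      (nhds (K * (μ : Measure ℝ).real (Icc 0 ((k : ℝ) / K)))) := fun k =>
    (tendsto_nat_floor_mul_div_atTop (by positivity)).comp tendsto_natCast_atTop_atTop
  rw [mul_sub]
  refine ((hq (j + 1)).sub (hq j)).congr fun m => ?_
  rw [Nat.cast_sub (monotone_quota μ K m j.le_succ), sub_div]

/-- Entropy lower bound for the number of ways to fill the blocks. -/
lemma eventually_log_prod_choose (h : (μ : Measure ℝ) ≤ Leb01) {K : ℕ} (hK : 1 ≤ K) {ε : ℝ}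
    (hε : 0 < ε) : ∀ᶠ m : ℕ in atTop,
      m * (K * ent μ - ε) ≤
        log (∏ j ∈ Finset.range K, m.choose (quota μ K m (j + 1) - quota μ K m j) : ℕ) := by
  have h1 : ∀ᶠ m : ℕ in atTop, K * ent μ - ε / 2 < ∑ j ∈ Finset.range K,
      binEntropy (((quota μ K m (j + 1) - quota μ K m j : ℕ) : ℝ) / m) :=
    (tendsto_sum_binEntropy_quota μ K).eventually
      (lt_mem_nhds (by linarith [mul_ent_le_sum h hK]))
  have h2 : ∀ᶠ m : ℕ in atTop, log ((m : ℝ) + 1) ≤ ε / (16 * K) * (m + 1) := by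
    have ht : Tendsto (fun m : ℕ => (m : ℝ) + 1) atTop atTop :=
      tendsto_atTop_add_const_right _ _ tendsto_natCast_atTop_atTop
    have hb := ht.eventually (isLittleO_log_id_atTop.bound (by positivity : 0 < ε / (16 * K)))
    filter_upwards [hb] with m hm
    simp only [id, norm_eq_abs] at hm
    rw [abs_of_nonneg (by positivity : (0 : ℝ) ≤ m + 1)] at hm
    exact (le_abs_self _).trans hm
  have h3 : ∀ᶠ m : ℕ in atTop, 8 * K / ε + 1 ≤ (m : ℝ) :=
    tendsto_natCast_atTop_atTop.eventually (eventually_ge_atTop _)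
  filter_upwards [h1, h2, h3, eventually_gt_atTop 0] with m h1 h2 h3 hm
  have hK' : (0 : ℝ) < K := by positivity
  have hm' : (0 : ℝ) < m := by positivity
  have hle : ∀ j, quota μ K m (j + 1) - quota μ K m j ≤ m := fun j => by
    have := quota_succ_le h hK m j; omega
  rw [Nat.cast_prod, log_prod fun j _ => by
    have := Nat.choose_pos (hle j); positivity]
  refine le_trans ?_ (Finset.sum_le_sum fun j _ => mul_binEntropy_div_le_log_choose hm (hle j))
  rw [Finset.sum_sub_distrib, ← Finset.mul_sum, Finset.sum_const, Finset.card_range, nsmul_eq_mul]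
  have e1 := mul_le_mul_of_nonneg_left h1.le hm'.le
  have e2 : K * (2 * log ((m : ℝ) + 1) + 2) ≤ m * (ε / 2) := by
    have a1 : K * (2 * log ((m : ℝ) + 1)) ≤ K * (2 * (ε / (16 * K) * (m + 1))) := by gcongr
    have a2 : K * (2 * (ε / (16 * K) * ((m : ℝ) + 1))) = ε / 8 * (m + 1) := by field_simp; ring
    have a3 : 8 * K + ε ≤ m * ε := by
      have := mul_le_mul_of_nonneg_right h3 hε.le
      have e : (8 * K / ε + 1) * ε = 8 * K + ε := by field_simp
      linarith
    nlinarith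
  nlinarith

end Distribution

lemma real_cell_inter_Icc {n : ℕ} (hn : 1 ≤ n) (i t : ℕ) :
    (volume.restrict (Icc ((i : ℝ) / n) (((i : ℝ) + 1) / n))).real (Icc 0 ((t : ℝ) / n)) =
      if i < t then (1 : ℝ) / n else 0 := by
  have hn' : (0 : ℝ) < n := by positivity
  rw [measureReal_restrict_apply measurableSet_Icc]
  split_ifs with h
  · have hit : ((i : ℝ) + 1) / n ≤ (t : ℝ) / n := by gcongr; exact_mod_cast h
    rw [inter_eq_right.2 (Icc_subset_Icc (by positivity) hit), Real.volume_real_Icc_of_le]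
    · ring
    · gcongr; linarith
  · have hti : (t : ℝ) / n ≤ (i : ℝ) / n := by gcongr; exact_mod_cast not_lt.1 h
    have : volume (Icc 0 ((t : ℝ) / n) ∩ Icc ((i : ℝ) / n) (((i : ℝ) + 1) / n)) = 0 :=
      measure_mono_null (t := {(i : ℝ) / n})
        (fun x hx => mem_singleton_iff.2 (le_antisymm (hx.1.2.trans hti) hx.2.1)) (by simp)
    rw [Measure.real, this, ENNReal.toReal_zero]

lemma real_sum_cells {n : ℕ} (hn : 1 ≤ n) (S : Finset (Fin n)) (t : ℕ) :
    (∑ a ∈ S, volume.restrict (Icc (((a : ℕ) : ℝ) / n) ((((a : ℕ) : ℝ) + 1) / n))).real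
      (Icc 0 ((t : ℝ) / n)) = ((S.filter fun a : Fin n => (a : ℕ) < t).card : ℝ) / n := by
  rw [Measure.real, Measure.finsetSum_apply, ENNReal.toReal_sum]
  · calc _ = ∑ a ∈ S, if (a : ℕ) < t then (1 : ℝ) / n else 0 :=
          Finset.sum_congr rfl fun a _ => real_cell_inter_Icc hn a t
      _ = _ := by
        rw [← Finset.sum_filter, Finset.sum_const, nsmul_eq_mul]
        ring
  · exact fun a _ => measure_ne_top _ _

lemma pi2_eq_sum {n : ℕ} (σ : Equiv.Perm (Fin n)) :
    pi2 σ = ∑ b ∈ (rlmPair σ).2,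
      volume.restrict (Icc (((b : ℕ) : ℝ) / n) ((((b : ℕ) : ℝ) + 1) / n)) := by
  rw [pi2, rlmPair, Finset.sum_image fun a _ b _ h => σ.injective h]

lemma exists_grid_point {n m K : ℕ} (hm : 0 < m) (hmn : (K + 1) * m ≤ n)
    (hnm : n ≤ (K + 1) * m + K) {x : ℝ} (hx : x ∈ Icc (0 : ℝ) 1) :
    ∃ j ≤ K + 1, |x - ((j * m : ℕ) : ℝ) / n| ≤ 1 / (K + 1) + (K + 1) / n := by
  have hn : 0 < n := lt_of_lt_of_le (by positivity) hmn
  have hn' : (0 : ℝ) < n := by exact_mod_cast hn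
  have hm' : (0 : ℝ) < m := by exact_mod_cast hm
  have hmn' : ((K : ℝ) + 1) * m ≤ n := by exact_mod_cast hmn
  have hnm' : (n : ℝ) ≤ (K + 1) * m + K := by exact_mod_cast hnm
  set k := ⌊x * n / m⌋₊ with hk
  have hk1 : (k : ℝ) ≤ x * n / m :=
    Nat.floor_le (div_nonneg (mul_nonneg hx.1 hn'.le) hm'.le)
  have hk2 : x * n / m < k + 1 := Nat.lt_floor_add_one _
  rw [le_div_iff₀ hm'] at hk1
  rw [div_lt_iff₀ hm'] at hk2
  have hb : (m : ℝ) / n ≤ 1 / (K + 1) := by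
    rw [div_le_div_iff₀ hn' (by positivity)]; linarith
  rcases le_total k (K + 1) with h | h
  · refine ⟨k, h, ?_⟩
    have e1 : ((k * m : ℕ) : ℝ) / n ≤ x := by rw [div_le_iff₀ hn']; push_cast; linarith
    have e2 : x - ((k * m : ℕ) : ℝ) / n ≤ m / n := by
      rw [sub_le_iff_le_add, ← add_div, le_div_iff₀ hn']; push_cast; linarith
    rw [abs_of_nonneg (by linarith)]
    have : 0 ≤ ((K : ℝ) + 1) / n := by positivity
    linarith
  · refine ⟨K + 1, le_rfl, ?_⟩
    have h' : ((K : ℝ) + 1) ≤ k := by exact_mod_cast h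
    have e0 : ((K : ℝ) + 1) * m ≤ k * m := by gcongr
    have e1 : (((K + 1) * m : ℕ) : ℝ) / n ≤ x := by rw [div_le_iff₀ hn']; push_cast; linarith
    have e2 : 1 ≤ (((K + 1) * m : ℕ) : ℝ) / n + (K + 1) / n := by
      rw [← add_div, le_div_iff₀ hn']; push_cast; linarith
    rw [abs_of_nonneg (by linarith)]
    have : 0 ≤ (1 : ℝ) / (K + 1) := by positivity
    linarith [hx.2]

/-- A measure whose block masses follow the quotas of `μ` is close to `μ`. -/
lemma abs_cdf_sub_le_of_quota {μ ν : FiniteMeasure ℝ} (hμ : (μ : Measure ℝ) ≤ Leb01)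
    (hν : (ν : Measure ℝ) ≤ Leb01) {n m K : ℕ} (hK : 1 ≤ K) (hm : 0 < m)
    (hmn : (K + 1) * m ≤ n) (hnm : n ≤ (K + 1) * m + K) {e : ℕ → ℕ}
    (he : ∀ j, e j ≤ j ∧ j ≤ e j + 1)
    (h : ∀ j ≤ K + 1, (ν : Measure ℝ).real (Icc 0 (((j * m : ℕ) : ℝ) / n)) =
      (quota μ K m (e j) : ℝ) / n) {x : ℝ} (hx : x ∈ Icc (0 : ℝ) 1) :
    |(ν : Measure ℝ).real (Icc 0 x) - (μ : Measure ℝ).real (Icc 0 x)| ≤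
      4 * (1 / K + (K + 1) / n) := by
  obtain ⟨j, hj, hxj⟩ := exists_grid_point hm hmn hnm hx
  obtain ⟨he1, he2⟩ := he j
  have hn' : (0 : ℝ) < n := by exact_mod_cast lt_of_lt_of_le (by positivity) hmn
  have hm' : (0 : ℝ) < m := by exact_mod_cast hm
  have hK' : (0 : ℝ) < K := by exact_mod_cast hK
  have hmn' : ((K : ℝ) + 1) * m ≤ n := by exact_mod_cast hmn
  have hnm' : (n : ℝ) ≤ (K + 1) * m + K := by exact_mod_cast hnm
  have hj' : (j : ℝ) ≤ K + 1 := by exact_mod_cast hj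
  have he1' : (e j : ℝ) ≤ j := by exact_mod_cast he1
  have he2' : (j : ℝ) ≤ e j + 1 := by exact_mod_cast he2
  have hinv : (1 : ℝ) / (K + 1) ≤ 1 / K := by gcongr; linarith
  set y : ℝ := ((j * m : ℕ) : ℝ) / n with hy
  have hy0 : 0 ≤ y := by positivity
  have a1 := abs_real_Icc_sub_le hν hx.1 hy0
  set F := (μ : Measure ℝ).real (Icc 0 ((e j : ℝ) / K)) with hF
  have hF0 : 0 ≤ F := measureReal_nonneg
  have hF1 : F ≤ 1 := real_Icc_le_one hμ _
  have a2 : |(ν : Measure ℝ).real (Icc 0 y) - F| ≤ 1 / K + (K + 1) / n := by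
    rw [h j hj]
    have q1 : (quota μ K m (e j) : ℝ) ≤ K * F * m := Nat.floor_le (by positivity)
    have q2 : K * F * m < quota μ K m (e j) + 1 := Nat.lt_floor_add_one _
    have hb : (m : ℝ) / n ≤ 1 / K := by
      refine le_trans ?_ hinv
      rw [div_le_div_iff₀ hn' (by positivity)]; linarith
    have hFm : F * (n - K * m) ≤ 1 * (m + K) :=
      mul_le_mul hF1 (by linarith) (by nlinarith) zero_le_one
    have hFm0 : 0 ≤ F * (n - K * m) := mul_nonneg hF0 (by nlinarith)
    rw [abs_le]
    constructor
    · have : F ≤ (quota μ K m (e j) : ℝ) / n + (m / n + (K + 1) / n) := by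
        rw [← add_div, ← add_div, le_div_iff₀ hn']
        nlinarith
      linarith
    · have : (quota μ K m (e j) : ℝ) / n ≤ F := by
        rw [div_le_iff₀ hn']; nlinarith
      have : 0 ≤ 1 / (K : ℝ) + (K + 1) / n := by positivity
      linarith
  have a3 := abs_real_Icc_sub_le hμ (x := (e j : ℝ) / K) (y := x) (by positivity) hx.1
  have a4 : |(e j : ℝ) / K - y| ≤ 1 / K + (K + 1) / n := by
    have y1 : y ≤ j / (K + 1) := by
      rw [hy, div_le_div_iff₀ hn' (by positivity)]; push_cast
      have := mul_le_mul_of_nonneg_left hmn' (Nat.cast_nonneg (α := ℝ) j)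
      linarith
    have y2 : j / (K + 1) ≤ y + (K + 1) / n := by
      rw [hy, ← add_div, div_le_div_iff₀ (by positivity) hn']; push_cast
      have := mul_le_mul_of_nonneg_left hnm' (Nat.cast_nonneg (α := ℝ) j)
      have := mul_le_mul_of_nonneg_right hj' hK'.le
      nlinarith
    have z1 : (e j : ℝ) / K ≤ j / (K + 1) + 1 / K := by
      rw [div_add_div _ _ (by positivity) hK'.ne', div_le_div_iff₀ hK' (by positivity)]
      have := mul_le_mul_of_nonneg_right he1' (by positivity : (0 : ℝ) ≤ (K + 1) * K)
      have := mul_le_mul_of_nonneg_right hj' hK'.le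
      nlinarith
    have z2 : (j : ℝ) / (K + 1) ≤ e j / K + 1 / K := by
      rw [← add_div]
      exact div_le_div₀ (by positivity) he2' hK' (by linarith)
    rw [abs_le]; constructor <;> linarith
  have t1 := abs_sub_le ((ν : Measure ℝ).real (Icc 0 x)) ((ν : Measure ℝ).real (Icc 0 y))
    ((μ : Measure ℝ).real (Icc 0 x))
  have t2 := abs_sub_le ((ν : Measure ℝ).real (Icc 0 y)) F ((μ : Measure ℝ).real (Icc 0 x))
  have t3 := abs_sub_le ((e j : ℝ) / K) y x
  rw [abs_sub_comm y x] at t3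
  linarith

lemma quota_le_quota (p : Dspace) (K m k : ℕ) : quota p.1.1 K m k ≤ quota p.1.2 K m k := by
  refine Nat.floor_le_floor ?_
  gcongr
  exact ENNReal.toReal_mono (measure_ne_top _ _) (p.2.2.2.2 _)

lemma quota_eq_quota (p : Dspace) {K : ℕ} (hK : 1 ≤ K) (m : ℕ) :
    quota p.1.1 K m K = quota p.1.2 K m K := by
  rw [quota_of_ge (fst_le_leb01 p) hK m le_rfl, quota_of_ge (snd_le_leb01 p) hK m le_rfl,
    Measure.real,
    Measure.real, p.2.2.2.1]

lemma prod_choose_quota_le_card {n m K : ℕ} (hK : 1 ≤ K) (hm : 0 < m) (hmn : (K + 1) * m ≤ n)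
    (hnm : n ≤ (K + 1) * m + K) (Pi : Equiv.Perm (Fin n) → Dspace)
    (hPi : ∀ σ, Avoids321 σ →
      ((Pi σ).1.1 : Measure ℝ) = pi1 σ ∧ ((Pi σ).1.2 : Measure ℝ) = pi2 σ)
    (p : Dspace) {δ : ℝ} (hδ : 4 * (1 / (K : ℝ) + (K + 1) / n) ≤ δ) {O : Set Dspace}
    (hO : ∀ q : Dspace, (∀ x ∈ Icc (0 : ℝ) 1, |cdf₁ q x - cdf₁ p x| ≤ δ) →
      (∀ x ∈ Icc (0 : ℝ) 1, |cdf₂ q x - cdf₂ p x| ≤ δ) → q ∈ O) :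
    (∏ j ∈ Finset.range K, m.choose (quota p.1.1 K m (j + 1) - quota p.1.1 K m j)) *
      (∏ j ∈ Finset.range K, m.choose (quota p.1.2 K m (j + 1) - quota p.1.2 K m j)) ≤
      (Finset.univ.filter fun σ => Avoids321 σ ∧ Pi σ ∈ O).card := by
  have hn : 1 ≤ n := lt_of_lt_of_le (by positivity) hmn
  let c : ℕ → ℕ := fun k => quota p.1.1 K m (k - 1)
  let d : ℕ → ℕ := fun k => quota p.1.2 K m k
  have hc0 : c 0 = 0 := quota_zero (fst_le_leb01 p) K m
  have hd0 : d 0 = 0 := quota_zero (snd_le_leb01 p) K m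
  have hc : Monotone c := (monotone_quota _ K m).comp fun a b h => Nat.sub_le_sub_right h 1
  have hd : Monotone d := monotone_quota _ K m
  have hdK : d (K + 1) = d K := by
    simp only [d]
    rw [quota_of_ge (snd_le_leb01 p) hK m le_rfl, quota_of_ge (snd_le_leb01 p) hK m (Nat.le_succ K)]
  have hblock : ∀ (S : Finset ℕ) (e : ℕ → ℕ), S ∈ blockSets m e (K + 1) → ∀ j ≤ K + 1,
      (∑ a ∈ toFin n S, volume.restrict
        (Icc (((a : ℕ) : ℝ) / n) ((((a : ℕ) : ℝ) + 1) / n))).real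
        (Icc 0 (((j * m : ℕ) : ℝ) / n)) = (e j : ℝ) / n := fun S e hS j hj => by
    obtain ⟨h1, h2⟩ := mem_blockSets.1 hS
    rw [real_sum_cells hn, card_filter_toFin (h1.trans (Finset.range_subset_range.2 hmn)), h2 j hj]
  have key := prod_choose_le_card_avoids321 hm hmn hc0 hd0 hc hd
    (fun k _ => quota_le_quota p K m k) ((quota_eq_quota p hK m).trans hdK.symm)
    (fun σ => Pi σ ∈ O) fun σ hσ A hA B hB hAB => by
      obtain ⟨e1, e2⟩ := hPi σ hσ
      refine hO _ (fun x hx => ?_) fun x hx => ?_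
      · refine (abs_cdf_sub_le_of_quota (fst_le_leb01 p) (fst_le_leb01 (Pi σ)) hK hm hmn hnm
          (e := fun j => j - 1) (fun j => by omega) (fun j hj => ?_) hx).trans hδ
        rw [e1, show pi1 σ = ∑ a ∈ (rlmPair σ).1, volume.restrict
          (Icc (((a : ℕ) : ℝ) / n) ((((a : ℕ) : ℝ) + 1) / n)) from rfl, hAB]
        exact hblock A c hA j hj
      · refine (abs_cdf_sub_le_of_quota (snd_le_leb01 p) (snd_le_leb01 (Pi σ)) hK hm hmn hnm
          (e := fun j => j) (fun j => by omega) (fun j hj => ?_) hx).trans hδ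
        rw [e2, pi2_eq_sum, hAB]
        exact hblock B d hB j hj
  rw [Finset.prod_range_succ', Finset.prod_range_succ (fun j => m.choose (d (j + 1) - d j)),
    hdK, Nat.sub_self, Nat.choose_zero_right, mul_one, Nat.sub_self, Nat.choose_zero_right,
    mul_one] at key
  exact key

lemma eventually_exp_le_card (Pi : ∀ n : ℕ, Equiv.Perm (Fin n) → Dspace)
    (hPi : ∀ n : ℕ, 1 ≤ n → ∀ σ : Equiv.Perm (Fin n), Avoids321 σ →
      ((Pi n σ).1.1 : Measure ℝ) = pi1 σ ∧ ((Pi n σ).1.2 : Measure ℝ) = pi2 σ)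
    {O : Set Dspace} (hO : IsOpen O) {p : Dspace} (hp : p ∈ O) {ε : ℝ} (hε : 0 < ε) :
    ∀ᶠ n : ℕ in atTop, exp (n * (ent p.1.1 + ent p.1.2 - ε)) ≤
      ((Finset.univ.filter fun σ : Equiv.Perm (Fin n) => Avoids321 σ ∧ Pi n σ ∈ O).card : ℝ) := by
  obtain ⟨δ, hδ, hball⟩ := exists_cdf_ball_subset hO hp
  set E := ent p.1.1 + ent p.1.2 with hE
  have hE0 : 0 ≤ E := add_nonneg (ent_nonneg (fst_le_leb01 p)) (ent_nonneg (snd_le_leb01 p))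
  obtain ⟨K, hKb⟩ := exists_nat_ge (max 1 (max (8 / δ) (4 * E / ε)))
  have hK1 : (1 : ℝ) ≤ K := (le_max_left _ _).trans hKb
  have hK2 : 8 / δ ≤ K := ((le_max_left _ _).trans (le_max_right _ _)).trans hKb
  have hK3 : 4 * E / ε ≤ K := ((le_max_right _ _).trans (le_max_right _ _)).trans hKb
  have hK : 1 ≤ K := by exact_mod_cast hK1
  have hK0 : (0 : ℝ) < K := by positivity
  have hδK : 4 * (1 / (K : ℝ)) ≤ δ / 2 := by
    rw [div_le_iff₀ hδ] at hK2
    rw [mul_one_div, div_le_iff₀ hK0]; linarith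
  rw [div_le_iff₀ hε] at hK3
  have hdiv : Tendsto (fun n : ℕ => n / (K + 1)) atTop atTop :=
    Nat.tendsto_div_const_atTop (by omega)
  have hε' : 0 < (K + 1) * ε / 8 := by positivity
  have h1 := hdiv.eventually (eventually_log_prod_choose (fst_le_leb01 p) hK hε')
  have h2 := hdiv.eventually (eventually_log_prod_choose (snd_le_leb01 p) hK hε')
  have h3 : ∀ᶠ n : ℕ in atTop, 4 * E / ε + 1 ≤ ((n / (K + 1) : ℕ) : ℝ) :=
    (tendsto_natCast_atTop_atTop.comp hdiv).eventually (eventually_ge_atTop _)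
  have h4 : ∀ᶠ n : ℕ in atTop, 8 * (K + 1) / δ ≤ (n : ℝ) :=
    tendsto_natCast_atTop_atTop.eventually (eventually_ge_atTop _)
  filter_upwards [h1, h2, h3, h4, eventually_ge_atTop 1] with n h1 h2 h3 h4 hn
  set m := n / (K + 1) with hm
  have hm0 : (0 : ℝ) < m := lt_of_lt_of_le (by positivity) h3
  have hmn : (K + 1) * m ≤ n := Nat.mul_div_le n (K + 1)
  have hnm : n ≤ (K + 1) * m + K := by
    have := Nat.lt_mul_div_succ n (Nat.succ_pos K)
    rw [Nat.succ_eq_add_one, ← hm, mul_add, mul_one] at this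
    omega
  have hn' : (0 : ℝ) < n := by exact_mod_cast hn
  have hδn : 4 * (1 / (K : ℝ) + (K + 1) / n) ≤ δ := by
    have : 4 * (((K : ℝ) + 1) / n) ≤ δ / 2 := by
      rw [div_le_iff₀ hδ] at h4
      rw [← mul_div_assoc, div_le_iff₀ hn']; linarith
    linarith
  have key := prod_choose_quota_le_card hK (by exact_mod_cast hm0) hmn hnm (Pi n) (hPi n hn) p hδn
    hball
  refine le_trans ?_ (Nat.cast_le.2 key)
  have hpos : ∀ μ : FiniteMeasure ℝ, (μ : Measure ℝ) ≤ Leb01 →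
      (0 : ℝ) < ((∏ j ∈ Finset.range K, m.choose (quota μ K m (j + 1) - quota μ K m j) : ℕ) : ℝ) :=
    fun μ hμ => Nat.cast_pos.2 <| Finset.prod_pos fun j _ => Nat.choose_pos <|
      Nat.sub_le_iff_le_add'.2 (quota_succ_le hμ hK m j)
  have g1 := (le_log_iff_exp_le (hpos _ (fst_le_leb01 p))).1 h1
  have g2 := (le_log_iff_exp_le (hpos _ (snd_le_leb01 p))).1 h2
  rw [Nat.cast_mul]
  refine le_trans ?_ (mul_le_mul g1 g2 (exp_pos _).le (Nat.cast_nonneg _))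
  rw [← exp_add, exp_le_exp]
  have a1 : (n : ℝ) * E ≤ ((K + 1) * m + K) * E :=
    mul_le_mul_of_nonneg_right (by exact_mod_cast hnm) hE0
  have a2 : ((K : ℝ) + 1) * m * ε ≤ n * ε :=
    mul_le_mul_of_nonneg_right (by exact_mod_cast hmn) hε.le
  have a3 := mul_le_mul_of_nonneg_left hK3 hm0.le
  have a4 : 4 * E ≤ (m - 1) * ε := by
    rw [← div_le_iff₀ hε]; linarith
  have a5 := mul_le_mul_of_nonneg_left a4 hK0.le
  have a6 : 0 ≤ m * ε := by positivity
  have a7 : 0 ≤ K * ε := by positivity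
  have a8 : 0 ≤ K * (m * ε) := by positivity
  nlinarith

lemma inv_mul_log_le {n : ℕ} (hn : 1 ≤ n) {q : ℝ≥0∞} {x : ℝ}
    (h : q ≤ ENNReal.ofReal (exp (n * x))) :
    (((n : ℝ)⁻¹ : ℝ) : EReal) * ENNReal.log q ≤ x := by
  have hn' : (n : ℝ) ≠ 0 := by positivity
  calc _ ≤ (((n : ℝ)⁻¹ : ℝ) : EReal) * ENNReal.log (ENNReal.ofReal (exp (n * x))) :=
        mul_le_mul_of_nonneg_left (ENNReal.log_monotone h)
          (EReal.coe_nonneg.2 (by positivity))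
    _ = x := by
        rw [ENNReal.log_ofReal_of_pos (exp_pos _), log_exp, ← EReal.coe_mul,
          inv_mul_cancel_left₀ hn']

lemma le_inv_mul_log {n : ℕ} (hn : 1 ≤ n) {q : ℝ≥0∞} {x : ℝ}
    (h : ENNReal.ofReal (exp (n * x)) ≤ q) :
    (x : EReal) ≤ (((n : ℝ)⁻¹ : ℝ) : EReal) * ENNReal.log q := by
  have hn' : (n : ℝ) ≠ 0 := by positivity
  calc (x : EReal) = (((n : ℝ)⁻¹ : ℝ) : EReal) * ENNReal.log (ENNReal.ofReal (exp (n * x))) := by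
        rw [ENNReal.log_ofReal_of_pos (exp_pos _), log_exp, ← EReal.coe_mul,
          inv_mul_cancel_left₀ hn']
    _ ≤ _ := mul_le_mul_of_nonneg_left (ENNReal.log_monotone h)
          (EReal.coe_nonneg.2 (by positivity))

/-- Half of the Lebesgue measure on `[0,1]`. -/
def halfLeb : FiniteMeasure ℝ := (2⁻¹ : ℝ≥0) • ⟨Leb01, inferInstance⟩

lemma coe_halfLeb : (halfLeb : Measure ℝ) = (2⁻¹ : ℝ≥0) • Leb01 := rfl

lemma halfLeb_le : (halfLeb : Measure ℝ) ≤ Leb01 := fun s => by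
  rw [coe_halfLeb, Measure.smul_apply, ENNReal.smul_def, smul_eq_mul]
  exact mul_le_of_le_one_left' (by exact_mod_cast inv_le_one_of_one_le₀ one_le_two)

lemma dens_halfLeb : ∀ᵐ x ∂Leb01, dens halfLeb x = 2⁻¹ := by
  have h1 : (halfLeb : Measure ℝ).rnDeriv volume =ᵐ[volume]
      (2⁻¹ : ℝ≥0) • Leb01.rnDeriv volume :=
    Measure.rnDeriv_smul_left Leb01 volume _
  have h2 : Leb01.rnDeriv volume =ᵐ[volume] (Icc (0 : ℝ) 1).indicator 1 :=
    Measure.rnDeriv_restrict_self volume measurableSet_Icc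
  filter_upwards [ae_restrict_of_ae h1, ae_restrict_of_ae h2, ae_restrict_mem measurableSet_Icc]
    with x h1 h2 hx
  rw [dens, h1, Pi.smul_apply, h2, indicator_of_mem hx]
  simp [ENNReal.smul_def]

lemma ent_halfLeb : ent halfLeb = log 2 := by
  rw [ent, integral_congr_ae (g := fun _ => log 2), integral_leb01_const]
  filter_upwards [dens_halfLeb] with x hx
  rw [hx, binEntropy_two_inv]

/-- The typical point, at which the rate function vanishes. -/
def typical : Dspace := ⟨(halfLeb, halfLeb), halfLeb_le, halfLeb_le, rfl, fun _ => le_rfl⟩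

lemma ent_typical : ent typical.1.1 + ent typical.1.2 = 2 * log 2 := by
  rw [show ent typical.1.1 = log 2 from ent_halfLeb, show ent typical.1.2 = log 2 from ent_halfLeb]
  ring

/-- The number of `321`-avoiding permutations of size `n`. -/
def count321 (n : ℕ) : ℕ := (Finset.univ.filter fun σ : Equiv.Perm (Fin n) => Avoids321 σ).card

lemma count321_pos (n : ℕ) : 0 < count321 n := by
  refine Finset.card_pos.2 ⟨1, Finset.mem_filter.2 ⟨Finset.mem_univ _, ?_⟩⟩
  rintro ⟨i, j, k, hij, -, h, -⟩
  exact lt_asymm hij h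

lemma count321_le {n : ℕ} (hn : 1 ≤ n) : (count321 n : ℝ) ≤ exp (n * (2 * log 2)) := by
  have h := card_avoids321_le_exp hn 0 0 0 (fun _ => True) fun σ _ _ => by simp
  have h0 : cumulant (0 : ℝ →ᵇ ℝ) = log 2 := by
    have : ∀ x, softplus ((0 : ℝ →ᵇ ℝ) x) = log 2 := fun x => by
      rw [softplus, BoundedContinuousFunction.coe_zero, Pi.zero_apply, exp_zero]; norm_num
    simp only [cumulant, this, integral_leb01_const]
  rw [h0, sub_zero, ← two_mul] at h
  simpa only [count321, and_true] using h

section Bounds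

variable {Pi : ∀ n : ℕ, Equiv.Perm (Fin n) → Dspace}

lemma probUnif321_eq (n : ℕ) (S : Set Dspace) : probUnif321 Pi n S =
    ENNReal.ofReal (((Finset.univ.filter fun σ : Equiv.Perm (Fin n) =>
      Avoids321 σ ∧ Pi n σ ∈ S).card : ℝ) / count321 n) := by
  rw [ENNReal.ofReal_div_of_pos (Nat.cast_pos.2 (count321_pos n)), ENNReal.ofReal_natCast,
    ENNReal.ofReal_natCast]
  rfl

variable (hPi : ∀ n : ℕ, 1 ≤ n → ∀ σ : Equiv.Perm (Fin n), Avoids321 σ →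
  ((Pi n σ).1.1 : Measure ℝ) = pi1 σ ∧ ((Pi n σ).1.2 : Measure ℝ) = pi2 σ)

include hPi

lemma eventually_exp_le_count321 {ε : ℝ} (hε : 0 < ε) :
    ∀ᶠ n : ℕ in atTop, exp (n * (2 * log 2 - ε)) ≤ count321 n := by
  have h := eventually_exp_le_card Pi hPi isOpen_univ (mem_univ typical) hε
  simpa only [count321, ent_typical, mem_univ, and_true] using h

lemma exists_forall_card_le {F : Set Dspace} (hF : IsClosed F) {c : ℝ} (hc : ∀ p ∈ F, c < rate p) :
    ∃ N : ℕ, ∀ n : ℕ, 1 ≤ n → ((Finset.univ.filter fun σ : Equiv.Perm (Fin n) =>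
      Avoids321 σ ∧ Pi n σ ∈ F).card : ℝ) ≤ N * exp (n * (2 * log 2 - c)) := by
  let U : (ℝ →ᵇ ℝ) × (ℝ →ᵇ ℝ) → Set Dspace := fun i =>
    {q | c < tilt i.1 i.2 q - cumulant i.1 - cumulant i.2 + 2 * log 2}
  obtain ⟨t, ht⟩ := hF.isCompact.elim_finite_subcover U
    (fun i => isOpen_lt continuous_const
      ((((continuous_tilt i.1 i.2).sub continuous_const).sub continuous_const).add
        continuous_const))
    fun p hp => by
      obtain ⟨f, g, h⟩ := exists_rate_lt_tilt p (hc p hp)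
      exact mem_iUnion.2 ⟨(f, g), h⟩
  refine ⟨t.card, fun n hn => ?_⟩
  have hsub : (Finset.univ.filter fun σ : Equiv.Perm (Fin n) => Avoids321 σ ∧ Pi n σ ∈ F) ⊆
      t.biUnion fun i => Finset.univ.filter fun σ : Equiv.Perm (Fin n) =>
        Avoids321 σ ∧ Pi n σ ∈ U i := fun σ hσ => by
    obtain ⟨-, h1, h2⟩ := Finset.mem_filter.1 hσ
    obtain ⟨i, hi, hU⟩ := mem_iUnion₂.1 (ht h2)
    exact Finset.mem_biUnion.2 ⟨i, hi, Finset.mem_filter.2 ⟨Finset.mem_univ _, h1, hU⟩⟩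
  calc _ ≤ ((∑ i ∈ t, (Finset.univ.filter fun σ : Equiv.Perm (Fin n) =>
          Avoids321 σ ∧ Pi n σ ∈ U i).card : ℕ) : ℝ) :=
        Nat.cast_le.2 ((Finset.card_le_card hsub).trans Finset.card_biUnion_le)
    _ = ∑ i ∈ t, ((Finset.univ.filter fun σ : Equiv.Perm (Fin n) =>
          Avoids321 σ ∧ Pi n σ ∈ U i).card : ℝ) := Nat.cast_sum _ _
    _ ≤ ∑ _i ∈ t, exp (n * (2 * log 2 - c)) := Finset.sum_le_sum fun i _ => by
        refine (card_avoids321_le_exp hn i.1 i.2 (c + cumulant i.1 + cumulant i.2 - 2 * log 2) _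
          fun σ hσ hU => ?_).trans_eq (by ring_nf)
        obtain ⟨e1, e2⟩ := hPi n hn σ hσ
        have hU' : c < tilt i.1 i.2 (Pi n σ) - cumulant i.1 - cumulant i.2 + 2 * log 2 := hU
        rw [tilt, e1, e2] at hU'
        linarith
    _ = _ := by rw [Finset.sum_const, nsmul_eq_mul]

lemma limsup_le {F : Set Dspace} (hF : IsClosed F) :
    limsup (fun n : ℕ => (((n : ℝ)⁻¹ : ℝ) : EReal) * ENNReal.log (probUnif321 Pi n F)) atTop ≤
      - ⨅ x ∈ F, H321 x := by
  refine EReal.le_of_forall_lt_iff_le.1 fun z hz => ?_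
  obtain ⟨y, hy, hyz⟩ := EReal.lt_iff_exists_real_btwn.1 hz
  have hyz : y < z := EReal.coe_lt_coe_iff.1 hyz
  obtain ⟨N, hN⟩ := exists_forall_card_le hPi hF (c := -y) fun p hp => by
    rw [← EReal.coe_lt_coe_iff, ← H321_eq_rate, EReal.coe_neg]
    exact (EReal.neg_lt_comm.1 hy).trans_le (iInf₂_le p hp)
  have hε : 0 < (z - y) / 2 := by linarith
  refine limsup_le_of_le (by isBoundedDefault) ?_
  have hlog : ∀ᶠ n : ℕ in atTop, log (N + 1) / ((z - y) / 2) ≤ (n : ℝ) :=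
    tendsto_natCast_atTop_atTop.eventually (eventually_ge_atTop _)
  filter_upwards [eventually_exp_le_count321 hPi hε, eventually_ge_atTop 1, hlog]
    with n hC hn hlog
  refine inv_mul_log_le hn ?_
  rw [probUnif321_eq]
  refine ENNReal.ofReal_le_ofReal ?_
  rw [div_le_iff₀ (Nat.cast_pos.2 (count321_pos n))]
  rw [div_le_iff₀ hε] at hlog
  have hN1 : (N : ℝ) ≤ exp (n * ((z - y) / 2)) :=
    (by linarith : (N : ℝ) ≤ N + 1).trans ((log_le_iff_le_exp (by positivity)).1 hlog)
  calc _ ≤ N * exp (n * (2 * log 2 - -y)) := hN n hn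
    _ ≤ exp (n * ((z - y) / 2)) * exp (n * (2 * log 2 - -y)) := by gcongr
    _ = exp (n * z) * exp (n * (2 * log 2 - (z - y) / 2)) := by
        rw [← exp_add, ← exp_add]; ring_nf
    _ ≤ _ := by gcongr

lemma le_liminf {O : Set Dspace} (hO : IsOpen O) :
    - ⨅ x ∈ O, H321 x ≤
      liminf (fun n : ℕ => (((n : ℝ)⁻¹ : ℝ) : EReal) * ENNReal.log (probUnif321 Pi n O)) atTop := by
  rw [EReal.neg_le]
  refine le_iInf₂ fun p hp => ?_
  rw [EReal.neg_le, H321_eq_rate, ← EReal.coe_neg]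
  refine EReal.ge_of_forall_gt_iff_ge.1 fun z hz => ?_
  have hz : z < -rate p := EReal.coe_lt_coe_iff.1 hz
  refine le_liminf_of_le (by isBoundedDefault) ?_
  filter_upwards [eventually_exp_le_card Pi hPi hO hp (ε := -rate p - z) (by linarith),
    eventually_ge_atTop 1] with n h hn
  refine le_inv_mul_log hn ?_
  rw [probUnif321_eq]
  refine ENNReal.ofReal_le_ofReal ?_
  rw [le_div_iff₀ (Nat.cast_pos.2 (count321_pos n))]
  calc _ ≤ exp (n * z) * exp (n * (2 * log 2)) := by gcongr; exact count321_le hn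
    _ = exp (n * (ent p.1.1 + ent p.1.2 - (-rate p - z))) := by
        rw [← exp_add, rate]; ring_nf
    _ ≤ _ := h

end Bounds

end LDP321

/-- Large deviation principle for the pairs of RLM occupation measures of uniform
`321`-avoiding permutations, at speed `n`, with rate function `H^{321}`.
Here `Pi n σ` is the pair `(π₁^σ, π₂^σ)` of rescaled occupation measures of positions
and values of the strict right-to-left minima of `σ`. -/
theorem LDP_uniform_321 (Pi : ∀ n : ℕ, Equiv.Perm (Fin n) → Dspace)
    (hPi : ∀ n : ℕ, 1 ≤ n → ∀ σ : Equiv.Perm (Fin n), Avoids321 σ →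
      ((Pi n σ).1.1 : Measure ℝ) = pi1 σ ∧ ((Pi n σ).1.2 : Measure ℝ) = pi2 σ) :
    SatisfiesLDP (probUnif321 Pi) H321 := by
  refine ⟨LDP321.lowerSemicontinuous_H321, fun p => ?_, fun F hF => LDP321.limsup_le hPi hF,
    fun O hO => LDP321.le_liminf hPi hO⟩
  rw [LDP321.H321_eq_rate]
  exact EReal.coe_nonneg.2 (LDP321.rate_nonneg p)

end
end

section
/- Fix β ∈ ℝ and define A_β on E by A_β(φ) := H^{231}(φ) − 2β·∫₀¹ φ(t) dt, where H^{231}(φ) := 2·∫₀¹ J(φ'(t)) dt, φ' is the almost-everywhere derivative of φ, and J(y) := ½(1+y)log(1+y) + ½(1−y)log(1−y) for y ∈ [−1,1] (with 0·log 0 = 0). Then A_β has a unique minimizer φ_β in E. If β ≤ 0, then φ_β ≡ 0. If β > 0, then φ_β(t) = (1/β)·log((1 + e^β)/(1 + e^{β(1−2t)})) − t for all t ∈ [0,1]. -/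
open MeasureTheory Filter Set

noncomputable section

/-- The set `E` of excursions: nonnegative `1`-Lipschitz functions with
`φ(0) = φ(1) = 0` (defined on `[0,1]` and extended by `0` to `ℝ`). -/
def Eset : Set (ℝ → ℝ) :=
  {φ | LipschitzWith 1 φ ∧ (∀ t : ℝ, 0 ≤ φ t) ∧ φ 0 = 0 ∧ φ 1 = 0 ∧
    ∀ t : ℝ, t ∉ Set.Icc (0:ℝ) 1 → φ t = 0}

/-- `J(y) = ½(1+y)log(1+y) + ½(1−y)log(1−y)` (with `0 log 0 = 0`). -/
def Jfun (y : ℝ) : ℝ :=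
  (1 + y) * Real.log (1 + y) / 2 + (1 - y) * Real.log (1 - y) / 2

/-- `H^{231}(φ) = 2∫₀¹ J(φ'(t)) dt`, where `φ'` is the almost-everywhere derivative of
the Lipschitz function `φ`. -/
def H231 (φ : ℝ → ℝ) : ℝ := 2 * ∫ t in (0:ℝ)..1, Jfun (deriv φ t)

/-- The action `A_β(φ) = H^{231}(φ) − 2β ∫₀¹ φ(t) dt`. -/
def A231 (β : ℝ) (φ : ℝ → ℝ) : ℝ := H231 φ - 2 * β * ∫ t in (0:ℝ)..1, φ t

/-- The defect in the Fenchel–Young inequality between `J` and its conjugate `log cosh`. -/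
def fenchelGap (l y : ℝ) : ℝ := Jfun y - l * y + Real.log (Real.cosh l)

/-- Global formula for the minimizer, nonnegative on `[0,1]` and nonpositive elsewhere. It is `0`
for `b = 0` by the convention `0⁻¹ = 0`. -/
def logCoshArch (b t : ℝ) : ℝ :=
  b⁻¹ * (Real.log (Real.cosh (b / 2)) - Real.log (Real.cosh (b * (1 / 2 - t))))

/-- The positive part of `logCoshArch`. -/
def optimalExcursion (b t : ℝ) : ℝ := max (logCoshArch b t) 0

theorem mul_klFun_div {a : ℝ} (ha : 0 < a) {x : ℝ} (hx : 0 ≤ x) :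
    a * InformationTheory.klFun (x / a) = x * Real.log x - x * Real.log a + a - x := by
  rcases hx.eq_or_lt with rfl | hx
  · simp [InformationTheory.klFun_apply]
  · rw [InformationTheory.klFun_apply, Real.log_div hx.ne' ha.ne']
    field_simp

theorem fenchelGap_eq {l y : ℝ} (hy : |y| ≤ 1) :
    fenchelGap l y =
      ((1 + Real.tanh l) * InformationTheory.klFun ((1 + y) / (1 + Real.tanh l)) +
        (1 - Real.tanh l) * InformationTheory.klFun ((1 - y) / (1 - Real.tanh l))) / 2 := by
  have hl := abs_lt.1 (Real.abs_tanh_lt_one l)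
  have hy' := abs_le.1 hy
  have hc := Real.cosh_pos l
  have h1 : Real.log (1 + Real.tanh l) = l - Real.log (Real.cosh l) := by
    have : 1 + Real.tanh l = Real.exp l / Real.cosh l := by
      rw [Real.tanh_eq_sinh_div_cosh, ← Real.cosh_add_sinh]
      field_simp
    rw [this, Real.log_div (Real.exp_pos l).ne' hc.ne', Real.log_exp]
  have h2 : Real.log (1 - Real.tanh l) = -l - Real.log (Real.cosh l) := by
    have : 1 - Real.tanh l = Real.exp (-l) / Real.cosh l := by
      rw [Real.tanh_eq_sinh_div_cosh, ← Real.cosh_sub_sinh]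
      field_simp
    rw [this, Real.log_div (Real.exp_pos _).ne' hc.ne', Real.log_exp]
  rw [mul_klFun_div (by linarith) (by linarith), mul_klFun_div (by linarith) (by linarith), h1, h2]
  unfold fenchelGap Jfun
  ring

theorem fenchelGap_nonneg {l y : ℝ} (hy : |y| ≤ 1) : 0 ≤ fenchelGap l y := by
  have hl := abs_lt.1 (Real.abs_tanh_lt_one l)
  have hy' := abs_le.1 hy
  have p1 : 0 < 1 + Real.tanh l := by linarith
  have p2 : 0 < 1 - Real.tanh l := by linarith
  have k1 := InformationTheory.klFun_nonneg (div_nonneg (by linarith : 0 ≤ 1 + y) p1.le)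
  have k2 := InformationTheory.klFun_nonneg (div_nonneg (by linarith : 0 ≤ 1 - y) p2.le)
  rw [fenchelGap_eq hy]
  positivity

theorem fenchelGap_eq_zero_iff {l y : ℝ} (hy : |y| ≤ 1) :
    fenchelGap l y = 0 ↔ y = Real.tanh l := by
  have hl := abs_lt.1 (Real.abs_tanh_lt_one l)
  have hy' := abs_le.1 hy
  have p1 : 0 < 1 + Real.tanh l := by linarith
  have p2 : 0 < 1 - Real.tanh l := by linarith
  have q1 : 0 ≤ (1 + y) / (1 + Real.tanh l) := div_nonneg (by linarith) p1.le
  have k1 := InformationTheory.klFun_nonneg q1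
  have k2 := InformationTheory.klFun_nonneg (div_nonneg (by linarith : 0 ≤ 1 - y) p2.le)
  rw [fenchelGap_eq hy]
  constructor
  · intro h
    have h1 : (1 + Real.tanh l) * InformationTheory.klFun ((1 + y) / (1 + Real.tanh l)) = 0 := by
      have := mul_nonneg p1.le k1
      have := mul_nonneg p2.le k2
      linarith
    have h2 := (InformationTheory.klFun_eq_zero_iff q1).1 ((mul_eq_zero.1 h1).resolve_left p1.ne')
    rw [div_eq_one_iff_eq p1.ne'] at h2
    linarith
  · rintro rfl
    simp [div_self p1.ne', div_self p2.ne', InformationTheory.klFun_one]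

theorem continuous_Jfun : Continuous Jfun := by
  unfold Jfun
  exact ((Real.continuous_mul_log.comp (continuous_const.add continuous_id)).div_const 2).add
    ((Real.continuous_mul_log.comp (continuous_const.sub continuous_id)).div_const 2)

theorem continuous_log_cosh_comp {f : ℝ → ℝ} (hf : Continuous f) :
    Continuous fun t => Real.log (Real.cosh (f t)) :=
  (Real.continuous_cosh.comp hf).log fun _ => (Real.cosh_pos _).ne'

theorem abs_deriv_le_one {ψ : ℝ → ℝ} (hψ : LipschitzWith 1 ψ) (t : ℝ) : |deriv ψ t| ≤ 1 := by
  simpa using norm_deriv_le_of_lipschitz (x₀ := t) hψ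

theorem LipschitzWith.absolutelyContinuous_interval {K : NNReal} {ψ : ℝ → ℝ}
    (hψ : LipschitzWith K ψ) (a b : ℝ) : AbsolutelyContinuousOnInterval ψ a b :=
  hψ.lipschitzOnWith.absolutelyContinuousOnInterval

theorem intervalIntegrable_Jfun_deriv {ψ : ℝ → ℝ} (hψ : LipschitzWith 1 ψ) :
    IntervalIntegrable (fun t => Jfun (deriv ψ t)) volume 0 1 := by
  obtain ⟨C, hC⟩ := (isCompact_Icc (a := (-1 : ℝ)) (b := 1)).exists_bound_of_continuousOn
    continuous_Jfun.continuousOn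
  refine (intervalIntegrable_const (c := C)).mono_fun
    (continuous_Jfun.measurable.comp (measurable_deriv ψ)).aestronglyMeasurable
    (Eventually.of_forall fun t => ?_)
  exact (hC _ (abs_le.1 (abs_deriv_le_one hψ t))).trans (le_abs_self C)

theorem integral_eq_integral_mul_deriv {ψ : ℝ → ℝ} (hψ : LipschitzWith 1 ψ)
    (h0 : ψ 0 = 0) (h1 : ψ 1 = 0) :
    ∫ t in (0:ℝ)..1, ψ t = ∫ t in (0:ℝ)..1, (1 / 2 - t) * deriv ψ t := by
  have hlin : LipschitzWith 1 fun t : ℝ => 1 / 2 - t :=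
    LipschitzWith.of_dist_le_mul fun x y => by
      rw [dist_sub_left, NNReal.coe_one, one_mul]
  rw [(hlin.absolutelyContinuous_interval 0 1).integral_mul_deriv_eq_deriv_mul
    (hψ.absolutelyContinuous_interval 0 1), h0, h1]
  simp

theorem intervalIntegrable_fenchelGap_deriv {ψ : ℝ → ℝ} (hψ : LipschitzWith 1 ψ) (b : ℝ) :
    IntervalIntegrable (fun t => fenchelGap (b * (1 / 2 - t)) (deriv ψ t)) volume 0 1 := by
  unfold fenchelGap
  refine ((intervalIntegrable_Jfun_deriv hψ).sub ?_).add
    ((continuous_log_cosh_comp (by fun_prop)).intervalIntegrable 0 1)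
  exact (hψ.absolutelyContinuous_interval 0 1).intervalIntegrable_deriv.continuousOn_mul
    (by fun_prop)

theorem A231_eq_fenchelGap {ψ : ℝ → ℝ} (hψ : ψ ∈ Eset) (b : ℝ) :
    A231 b ψ = 2 * (∫ t in (0:ℝ)..1, fenchelGap (b * (1 / 2 - t)) (deriv ψ t)) -
      2 * ∫ t in (0:ℝ)..1, Real.log (Real.cosh (b * (1 / 2 - t))) := by
  obtain ⟨hL, -, h0, h1, -⟩ := hψ
  have i1 := intervalIntegrable_Jfun_deriv hL
  have i2 : IntervalIntegrable (fun t => b * (1 / 2 - t) * deriv ψ t) volume 0 1 :=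
    (hL.absolutelyContinuous_interval 0 1).intervalIntegrable_deriv.continuousOn_mul
      (by fun_prop)
  have i3 : IntervalIntegrable (fun t => Real.log (Real.cosh (b * (1 / 2 - t)))) volume 0 1 :=
    (continuous_log_cosh_comp (by fun_prop)).intervalIntegrable 0 1
  have hb : ∫ t in (0:ℝ)..1, b * (1 / 2 - t) * deriv ψ t = b * ∫ t in (0:ℝ)..1, ψ t := by
    rw [integral_eq_integral_mul_deriv hL h0 h1, ← intervalIntegral.integral_const_mul]
    simp only [mul_assoc]
  unfold fenchelGap A231 H231
  rw [intervalIntegral.integral_add (i1.sub i2) i3, intervalIntegral.integral_sub i1 i2, hb]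
  ring

theorem integral_fenchelGap_deriv_nonneg {ψ : ℝ → ℝ} (hψ : LipschitzWith 1 ψ) (b : ℝ) :
    0 ≤ ∫ t in (0:ℝ)..1, fenchelGap (b * (1 / 2 - t)) (deriv ψ t) :=
  intervalIntegral.integral_nonneg zero_le_one fun t _ =>
    fenchelGap_nonneg (abs_deriv_le_one hψ t)

theorem hasDerivAt_logCoshArch (b t : ℝ) :
    HasDerivAt (logCoshArch b) (Real.tanh (b * (1 / 2 - t))) t := by
  have h1 : HasDerivAt (fun t : ℝ => b * (1 / 2 - t)) (b * (-1)) t :=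
    ((hasDerivAt_id t).const_sub (1 / 2)).const_mul b
  have h2 := (((h1.cosh).log (Real.cosh_pos _).ne').const_sub
    (Real.log (Real.cosh (b / 2)))).const_mul b⁻¹
  refine h2.congr_deriv ?_
  rw [Real.tanh_eq_sinh_div_cosh]
  rcases eq_or_ne b 0 with rfl | hb
  · simp
  · field_simp

theorem lipschitzWith_logCoshArch (b : ℝ) : LipschitzWith 1 (logCoshArch b) := by
  refine lipschitzWith_of_nnnorm_deriv_le
    (fun t => (hasDerivAt_logCoshArch b t).differentiableAt) fun t => ?_
  rw [(hasDerivAt_logCoshArch b t).deriv, ← NNReal.coe_le_coe]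
  exact (Real.abs_tanh_lt_one _).le

theorem logCoshArch_nonneg {b t : ℝ} (hb : 0 ≤ b) (ht : t ∈ Icc (0:ℝ) 1) :
    0 ≤ logCoshArch b t := by
  refine mul_nonneg (inv_nonneg.2 hb) (sub_nonneg.2 (Real.log_le_log (Real.cosh_pos _) ?_))
  rw [Real.cosh_le_cosh, div_eq_mul_one_div b, abs_mul, abs_mul]
  refine mul_le_mul_of_nonneg_left ?_ (abs_nonneg b)
  rw [abs_of_pos (by norm_num : (0:ℝ) < 1 / 2), abs_le]
  constructor <;> linarith [ht.1, ht.2]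

theorem logCoshArch_nonpos {b t : ℝ} (hb : 0 ≤ b) (ht : t ∉ Ioo (0:ℝ) 1) :
    logCoshArch b t ≤ 0 := by
  refine mul_nonpos_of_nonneg_of_nonpos (inv_nonneg.2 hb)
    (sub_nonpos.2 (Real.log_le_log (Real.cosh_pos _) ?_))
  rw [Real.cosh_le_cosh, div_eq_mul_one_div b, abs_mul, abs_mul]
  refine mul_le_mul_of_nonneg_left ?_ (abs_nonneg b)
  rw [abs_of_pos (by norm_num : (0:ℝ) < 1 / 2), le_abs]
  by_cases h : 0 < t
  · right
    have : 1 ≤ t := not_lt.1 fun h' => ht ⟨h, h'⟩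
    linarith
  · left
    linarith

theorem optimalExcursion_of_mem {b t : ℝ} (hb : 0 ≤ b) (ht : t ∈ Icc (0:ℝ) 1) :
    optimalExcursion b t = logCoshArch b t :=
  max_eq_left (logCoshArch_nonneg hb ht)

theorem optimalExcursion_mem_Eset {b : ℝ} (hb : 0 ≤ b) : optimalExcursion b ∈ Eset := by
  have hz : ∀ t ∉ Ioo (0:ℝ) 1, optimalExcursion b t = 0 := fun t ht =>
    max_eq_right (logCoshArch_nonpos hb ht)
  exact ⟨(lipschitzWith_logCoshArch b).max_const 0, fun t => le_max_right _ _,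
    hz 0 (by simp), hz 1 (by simp), fun t ht => hz t fun h => ht (Ioo_subset_Icc_self h)⟩

theorem deriv_optimalExcursion {b t : ℝ} (hb : 0 ≤ b) (ht : t ∈ Ioo (0:ℝ) 1) :
    deriv (optimalExcursion b) t = Real.tanh (b * (1 / 2 - t)) := by
  have : optimalExcursion b =ᶠ[nhds t] logCoshArch b := by
    filter_upwards [Ioo_mem_nhds ht.1 ht.2] with s hs
    exact optimalExcursion_of_mem hb (Ioo_subset_Icc_self hs)
  rw [this.deriv_eq, (hasDerivAt_logCoshArch b t).deriv]

theorem A231_optimalExcursion {b : ℝ} (hb : 0 ≤ b) :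
    A231 b (optimalExcursion b) =
      -(2 * ∫ t in (0:ℝ)..1, Real.log (Real.cosh (b * (1 / 2 - t)))) := by
  have hE := optimalExcursion_mem_Eset hb
  have : ∫ t in (0:ℝ)..1, fenchelGap (b * (1 / 2 - t)) (deriv (optimalExcursion b) t) = 0 := by
    rw [intervalIntegral.integral_of_le zero_le_one, integral_Ioc_eq_integral_Ioo]
    refine setIntegral_eq_zero_of_forall_eq_zero fun t ht => ?_
    exact (fenchelGap_eq_zero_iff (abs_deriv_le_one hE.1 t)).2 (deriv_optimalExcursion hb ht)
  rw [A231_eq_fenchelGap hE, this]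
  ring

theorem A231_optimalExcursion_le {b : ℝ} (hb : 0 ≤ b) {ψ : ℝ → ℝ} (hψ : ψ ∈ Eset) :
    A231 b (optimalExcursion b) ≤ A231 b ψ := by
  rw [A231_optimalExcursion hb, A231_eq_fenchelGap hψ]
  linarith [integral_fenchelGap_deriv_nonneg hψ.1 b]

theorem eq_of_ae_deriv_eq {ψ φ : ℝ → ℝ} (hψ : ψ ∈ Eset) (hφ : φ ∈ Eset)
    (h : ∀ᵐ t ∂volume.restrict (Ioc (0:ℝ) 1), deriv ψ t = deriv φ t) : ψ = φ := by
  funext t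
  by_cases ht : t ∈ Icc (0:ℝ) 1
  · have e1 := (hψ.1.absolutelyContinuous_interval 0 t).integral_deriv_eq_sub
    have e2 := (hφ.1.absolutelyContinuous_interval 0 t).integral_deriv_eq_sub
    rw [hψ.2.2.1, sub_zero] at e1
    rw [hφ.2.2.1, sub_zero] at e2
    rw [← e1, ← e2]
    refine intervalIntegral.integral_congr_ae ?_
    filter_upwards [(ae_restrict_iff' measurableSet_Ioc).1 h] with s hs hst
    rw [uIoc_of_le ht.1] at hst
    exact hs ⟨hst.1, hst.2.trans ht.2⟩
  · rw [hψ.2.2.2.2 t ht, hφ.2.2.2.2 t ht]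

theorem eq_optimalExcursion_of_A231_le {b : ℝ} (hb : 0 ≤ b) {ψ : ℝ → ℝ} (hψ : ψ ∈ Eset)
    (h : A231 b ψ ≤ A231 b (optimalExcursion b)) : ψ = optimalExcursion b := by
  rw [A231_optimalExcursion hb, A231_eq_fenchelGap hψ] at h
  have hz : ∫ t in (0:ℝ)..1, fenchelGap (b * (1 / 2 - t)) (deriv ψ t) = 0 :=
    le_antisymm (by linarith) (integral_fenchelGap_deriv_nonneg hψ.1 b)
  rw [intervalIntegral.integral_eq_zero_iff_of_le_of_nonneg_ae zero_le_one
    (Eventually.of_forall fun t => fenchelGap_nonneg (abs_deriv_le_one hψ.1 t))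
    (intervalIntegrable_fenchelGap_deriv hψ.1 b)] at hz
  refine eq_of_ae_deriv_eq hψ (optimalExcursion_mem_Eset hb) ?_
  rw [← restrict_Ioo_eq_restrict_Ioc] at hz ⊢
  filter_upwards [hz, ae_restrict_mem measurableSet_Ioo] with t ht htm
  rw [deriv_optimalExcursion hb htm]
  exact (fenchelGap_eq_zero_iff (abs_deriv_le_one hψ.1 t)).1 ht

theorem optimalExcursion_zero : optimalExcursion 0 = 0 := by
  funext t
  simp [optimalExcursion, logCoshArch]

theorem logCoshArch_eq {b : ℝ} (hb : 0 < b) (t : ℝ) :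
    logCoshArch b t =
      (1 / b) * Real.log ((1 + Real.exp b) / (1 + Real.exp (b * (1 - 2 * t)))) - t := by
  have key : ∀ x : ℝ, Real.log (1 + Real.exp (2 * x)) =
      x + Real.log 2 + Real.log (Real.cosh x) := by
    intro x
    have : 1 + Real.exp (2 * x) = Real.exp x * 2 * Real.cosh x := by
      rw [Real.cosh_eq, two_mul, Real.exp_add, Real.exp_neg]
      field_simp
      ring
    rw [this, Real.log_mul (by positivity) (Real.cosh_pos x).ne',
      Real.log_mul (by positivity) two_ne_zero, Real.log_exp]
  have k1 := key (b / 2)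
  have k2 := key (b * (1 / 2 - t))
  rw [show 2 * (b / 2) = b by ring] at k1
  rw [show 2 * (b * (1 / 2 - t)) = b * (1 - 2 * t) by ring] at k2
  rw [Real.log_div (by positivity) (by positivity), k1, k2, logCoshArch]
  field_simp
  ring

/-- The action `A_β` has a unique minimizer `φ_β` on `E`; it is `0` for `β ≤ 0`, and
`φ_β(t) = (1/β) log((1+e^β)/(1+e^{β(1−2t)})) − t` for `β > 0`. -/
theorem unique_minimizer_action_231 (β : ℝ) :
    ∃ φβ ∈ Eset,
      (∀ ψ ∈ Eset, A231 β φβ ≤ A231 β ψ) ∧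
      (∀ ψ ∈ Eset, (∀ χ ∈ Eset, A231 β ψ ≤ A231 β χ) → ψ = φβ) ∧
      (β ≤ 0 → ∀ t ∈ Set.Icc (0:ℝ) 1, φβ t = 0) ∧
      (0 < β → ∀ t ∈ Set.Icc (0:ℝ) 1,
        φβ t = (1 / β) *
          Real.log ((1 + Real.exp β) / (1 + Real.exp (β * (1 - 2 * t)))) - t) := by
  have hb : 0 ≤ max β 0 := le_max_right _ _
  have hE := optimalExcursion_mem_Eset hb
  have hshift : ∀ ψ : ℝ → ℝ, A231 β ψ =
      A231 (max β 0) ψ + 2 * (max β 0 - β) * ∫ t in (0:ℝ)..1, ψ t := by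
    intro ψ
    unfold A231
    ring
  have hle : ∀ ψ ∈ Eset, A231 (max β 0) ψ ≤ A231 β ψ := by
    intro ψ hψ
    have h1 : 0 ≤ ∫ t in (0:ℝ)..1, ψ t :=
      intervalIntegral.integral_nonneg zero_le_one fun t _ => hψ.2.1 t
    have h2 : 0 ≤ max β 0 - β := sub_nonneg.2 (le_max_left _ _)
    rw [hshift ψ]
    exact le_add_of_nonneg_right (by positivity)
  have heq : A231 β (optimalExcursion (max β 0)) =
      A231 (max β 0) (optimalExcursion (max β 0)) := by
    rcases le_total β 0 with h | h
    · rw [hshift, max_eq_right h, optimalExcursion_zero]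
      simp
    · rw [max_eq_left h]
  refine ⟨optimalExcursion (max β 0), hE, fun ψ hψ => ?_, fun ψ hψ hmin => ?_,
    fun h t _ => ?_, fun h t ht => ?_⟩
  · rw [heq]
    exact (A231_optimalExcursion_le hb hψ).trans (hle ψ hψ)
  · exact eq_optimalExcursion_of_A231_le hb hψ ((hle ψ hψ).trans ((hmin _ hE).trans_eq heq))
  · rw [max_eq_right h, optimalExcursion_zero, Pi.zero_apply]
  · rw [max_eq_left h.le, optimalExcursion_of_mem h.le ht, logCoshArch_eq h]

end
end
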